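/- arXiv:1809.04864 — 2 statements merged into one kernel-verified Lean document; each statement's English description precedes it below -/
import Mathlib

section
/- For every Boolean function f ∈ B_9, the second-order nonlinearity satisfies nl_2(f) ≤ 216; that is, the covering radius of RM(2,9) is at most 216. -/
open scoped BigOperators

/-- Boolean functions in `n` variables. -/
abbrev BF (n : ℕ) := (Fin n → ZMod 2) → ZMod 2

/-- Hamming distance between two Boolean functions. -/
def hd {n : ℕ} (f g : BF n) : ℕ :=
  (Finset.univ.filter (fun x : Fin n → ZMod 2 => f x ≠ g x)).card

/-- The Reed--Muller code `RM(r,n)`: Boolean functions given by evaluation of a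
multivariate polynomial over `F_2` of total degree at most `r`. -/
def RM (r n : ℕ) : Set (BF n) :=
  {f | ∃ p : MvPolynomial (Fin n) (ZMod 2),
    p.totalDegree ≤ r ∧ ∀ x, f x = MvPolynomial.eval x p}

/-- The `r`-th order nonlinearity of a Boolean function. -/
noncomputable def nl (r : ℕ) {n : ℕ} (f : BF n) : ℕ :=
  sInf {d | ∃ g ∈ RM r n, d = hd f g}

/-- Concatenation `f1 || f2` of two Boolean functions. -/
def concat {n : ℕ} (f1 f2 : BF n) : BF (n + 1) :=
  fun x => (1 + x (Fin.last n)) * f1 (x ∘ Fin.castSucc)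
    + x (Fin.last n) * f2 (x ∘ Fin.castSucc)

/-- A Boolean function is homogeneous quadratic if it is of the form
`∑_{i<j} a_{ij} x_i x_j`. -/
def HomQuad {n : ℕ} (g : BF n) : Prop :=
  ∃ a : Fin n → Fin n → ZMod 2,
    ∀ x, g x = ∑ i : Fin n, ∑ j : Fin n, (if i < j then a i j * x i * x j else 0)

/-- `Fh f r` is the set of homogeneous quadratic functions `g` with `nl(f+g) = r`. -/
def Fh {n : ℕ} (f : BF n) (r : ℕ) : Set (BF n) :=
  {g | HomQuad g ∧ nl 1 (f + g) = r}

/-- `NFh f r = |Fh f r|`. -/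
noncomputable def NFh {n : ℕ} (f : BF n) (r : ℕ) : ℕ := (Fh f r).ncard

/-- The set of 6-variable Boolean functions with nonlinearity 16. -/
def S16 : Set (BF 6) := {f | nl 1 f = 16}

/-- `f1` and `f2` are affine equivalent modulo `RM(r,n)`. -/
def AffEquivMod (r n : ℕ) (f1 f2 : BF n) : Prop :=
  ∃ A : Matrix (Fin n) (Fin n) (ZMod 2), IsUnit A ∧ ∃ b : Fin n → ZMod 2,
    (fun x => f1 x + f2 (A.mulVec x + b)) ∈ RM r n

def fun1 : BF 6 := fun x => x 0*x 1*x 5 + x 0*x 2*x 4 + x 1*x 2*x 3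

def fun2 : BF 6 := fun x => x 0*x 1*x 2*x 3 + x 0*x 1*x 5 + x 0*x 3*x 4 + x 1*x 2*x 4

def fun3 : BF 6 := fun x => x 0*x 1*x 2*x 3 + x 0*x 2*x 4 + x 0*x 3*x 5 + x 1*x 2*x 4
  + x 1*x 2*x 5 + x 1*x 3*x 4

def fun4 : BF 6 := fun x => x 0*x 1*x 2*x 5 + x 0*x 1*x 3*x 4 + x 0*x 2*x 4
  + x 0*x 3*x 4 + x 0*x 3*x 5 + x 1*x 2*x 3

def fun5 : BF 6 := fun x => x 0*x 1*x 2*x 3*x 4 + x 0*x 2*x 4 + x 0*x 3*x 5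
  + x 1*x 2*x 4 + x 1*x 2*x 5 + x 1*x 3*x 4

def fun6 : BF 6 := fun x => x 0*x 1*x 2*x 3*x 4*x 5 + x 0*x 1*x 5 + x 0*x 2*x 4
  + x 1*x 2*x 3

def fun7 : BF 6 := fun x => x 0*x 1*x 2*x 3*x 4*x 5 + x 0*x 1*x 2*x 3 + x 0*x 1*x 5
  + x 0*x 3*x 4 + x 1*x 2*x 4 + x 3*x 4

def fun8 : BF 6 := fun x => x 0*x 1*x 2*x 3*x 4*x 5 + x 0*x 1*x 2*x 3 + x 0*x 2*x 4
  + x 0*x 3*x 5 + x 1*x 2*x 4 + x 1*x 2*x 5 + x 1*x 3*x 4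

def fun9 : BF 6 := fun x => x 0*x 1*x 2*x 3*x 4*x 5 + x 0*x 1*x 2*x 5 + x 0*x 1*x 3*x 4
  + x 0*x 2*x 4 + x 0*x 3*x 4 + x 0*x 3*x 5 + x 1*x 2*x 3 + x 3*x 5

def fun10 : BF 6 := fun x => x 0*x 1*x 2*x 3*x 4*x 5 + x 0*x 1*x 2*x 3 + x 0*x 2*x 3
  + x 0*x 4*x 5 + x 1*x 2*x 3 + x 1*x 2*x 5 + x 1*x 3*x 4 + x 2*x 3 + x 2*x 5 + x 3*x 4

def fun11 : BF 6 := fun x => x 0*x 1*x 2*x 3*x 4*x 5 + x 0*x 1*x 2*x 5 + x 0*x 1*x 3*x 4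
  + x 0*x 2*x 4 + x 0*x 3*x 4 + x 0*x 3*x 5 + x 1*x 2*x 3 + x 1*x 2*x 5 + x 1*x 3*x 4
  + x 2*x 4 + x 3*x 4 + x 3*x 5

def fun12 : BF 6 := fun x => x 0*x 1*x 2*x 3*x 4*x 5 + x 1*x 2*x 3*x 4 + x 0*x 1*x 4*x 5
  + x 0*x 2*x 3*x 5 + x 0*x 1*x 3 + x 0*x 1*x 4 + x 1*x 2*x 4 + x 2*x 3*x 4
  + x 0*x 1*x 5 + x 2*x 3*x 5

def g0 : BF 6 := fun x => x 0*x 1*x 2 + x 0*x 3*x 4 + x 1*x 3*x 5 + x 2*x 4*x 5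
  + x 3*x 4*x 5

/-- The nontrivial additive character of `F_2`, with rational values. -/
def sgn (z : ZMod 2) : ℚ := if z = 0 then 1 else -1

lemma zmod_two_cases (z : ZMod 2) : z = 0 ∨ z = 1 := by
  revert z; decide

lemma sgn_zero : sgn 0 = 1 := by simp [sgn]

lemma sgn_one : sgn 1 = -1 := by simp [sgn]

lemma sgn_add (y z : ZMod 2) : sgn (y + z) = sgn y * sgn z := by
  have h : (1 + 1 : ZMod 2) = 0 := by decide
  rcases zmod_two_cases y with rfl | rfl <;> rcases zmod_two_cases z with rfl | rfl <;>
    simp [sgn, h]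

lemma sgn_mul_self (z : ZMod 2) : sgn z * sgn z = 1 := by
  rcases zmod_two_cases z with rfl | rfl <;> simp [sgn]

lemma sgn_sum {α : Type*} (A : Finset α) (y : α → ZMod 2) :
    sgn (∑ x ∈ A, y x) = ∏ x ∈ A, sgn (y x) := by
  classical
  induction A using Finset.induction_on with
  | empty => simp [sgn_zero]
  | insert a A ha ih => rw [Finset.sum_insert ha, Finset.prod_insert ha, sgn_add, ih]

lemma sum_sgn_mul (y : ZMod 2) : ∑ z : ZMod 2, sgn (z * y) = if y = 0 then 2 else 0 := by
  have h : (Finset.univ : Finset (ZMod 2)) = {0, 1} := by decide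
  rw [h, Finset.sum_pair (by decide)]
  rcases zmod_two_cases y with rfl | rfl <;> norm_num [sgn]

/-- Orthogonality of the characters of `F_2^ι`. -/
lemma sum_sgn_dotProduct {ι : Type*} [Fintype ι] [DecidableEq ι] (y : ι → ZMod 2) :
    ∑ w : ι → ZMod 2, sgn (w ⬝ᵥ y) = if y = 0 then 2 ^ Fintype.card ι else 0 := by
  simp only [dotProduct, sgn_sum]
  have h := Finset.prod_univ_sum (fun _ : ι => (Finset.univ : Finset (ZMod 2)))
    (fun i z => sgn (z * y i))
  rw [Fintype.piFinset_univ] at h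
  rw [← h]
  simp only [sum_sgn_mul]
  split_ifs with hy
  · subst hy; simp
  · obtain ⟨i, hi⟩ := Function.ne_iff.mp hy
    exact Finset.prod_eq_zero (Finset.mem_univ i) (if_neg hi)

/-- The elementary symmetric polynomial of degree `k` in the values `s x`, `x ∈ A`. -/
def elemSymm {α : Type*} (A : Finset α) (s : α → ℚ) (k : ℕ) : ℚ :=
  ∑ S ∈ A.powersetCard k, ∏ x ∈ S, s x

lemma elemSymm_zero {α : Type*} (A : Finset α) (s : α → ℚ) : elemSymm A s 0 = 1 := by
  simp [elemSymm]

lemma elemSymm_empty_succ {α : Type*} (s : α → ℚ) (k : ℕ) : elemSymm ∅ s (k + 1) = 0 := by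
  rw [elemSymm, Finset.powersetCard_eq_empty.mpr (by simp), Finset.sum_empty]

section ElemSymm

variable {α : Type*} [DecidableEq α]

lemma elemSymm_insert {a : α} {A : Finset α} (ha : a ∉ A) (s : α → ℚ) (k : ℕ) :
    elemSymm (insert a A) s (k + 1) = elemSymm A s (k + 1) + s a * elemSymm A s k := by
  unfold elemSymm
  rw [Finset.powersetCard_succ_insert ha, Finset.sum_union, Finset.sum_image, Finset.mul_sum]
  · congr 1
    refine Finset.sum_congr rfl fun S hS => ?_
    rw [Finset.prod_insert fun h => ha ((Finset.mem_powersetCard.mp hS).1 h)]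
  · intro S hS T hT h
    have hS' : a ∉ S := fun h => ha ((Finset.mem_powersetCard.mp hS).1 h)
    have hT' : a ∉ T := fun h => ha ((Finset.mem_powersetCard.mp hT).1 h)
    rw [← Finset.erase_insert hS', ← Finset.erase_insert hT', h]
  · rw [Finset.disjoint_left]
    intro S hS hS'
    obtain ⟨T, -, rfl⟩ := Finset.mem_image.mp hS'
    exact ha ((Finset.mem_powersetCard.mp hS).1 (Finset.mem_insert_self a T))

lemma elemSymm_one (A : Finset α) (s : α → ℚ) : elemSymm A s 1 = ∑ x ∈ A, s x := by
  induction A using Finset.induction_on with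
  | empty => simp [elemSymm_empty_succ]
  | insert a A ha ih =>
    rw [elemSymm_insert ha, ih, Finset.sum_insert ha, elemSymm_zero]; ring

/-- Krawtchouk recurrence for the elementary symmetric polynomials of signs. -/
lemma elemSymm_add_two (A : Finset α) (s : α → ℚ) (hs : ∀ x, s x * s x = 1) (k : ℕ) :
    (k + 2) * elemSymm A s (k + 2) =
      (∑ x ∈ A, s x) * elemSymm A s (k + 1) - (A.card - k) * elemSymm A s k := by
  induction A using Finset.induction_on generalizing k with
  | empty =>
    rcases k with _ | k
    · simp [elemSymm_empty_succ]
    · simp [elemSymm_empty_succ]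
  | insert a A ha ih =>
    rw [elemSymm_insert ha, elemSymm_insert ha, Finset.sum_insert ha,
      Finset.card_insert_of_notMem ha]
    rcases k with _ | k
    · have h := ih 0
      simp only [zero_add, elemSymm_zero, elemSymm_one] at *
      push_cast at *
      linear_combination h - hs a
    · rw [elemSymm_insert ha]
      have h := ih (k + 1)
      have h' := ih k
      push_cast at *
      linear_combination h + s a * h' - elemSymm A s (k + 1) * hs a

end ElemSymm

/-- Averaging elementary symmetric polynomials of twisted signs over all characters. -/
lemma sum_elemSymm {α ι : Type*} [DecidableEq α] [Fintype ι] [DecidableEq ι]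
    (φ : α → ι → ZMod 2) (A : Finset α) (t : α → ℚ) (k : ℕ) :
    ∑ w : ι → ZMod 2, elemSymm A (fun x => t x * sgn (w ⬝ᵥ φ x)) k =
      2 ^ Fintype.card ι *
        ∑ S ∈ (A.powersetCard k).filter (fun S => ∑ x ∈ S, φ x = 0), ∏ x ∈ S, t x := by
  unfold elemSymm
  rw [Finset.sum_comm, Finset.sum_filter, Finset.mul_sum]
  refine Finset.sum_congr rfl fun S _ => ?_
  simp only [Finset.prod_mul_distrib, ← sgn_sum, ← dotProduct_sum, ← Finset.mul_sum,
    sum_sgn_dotProduct]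
  split_ifs <;> ring

/-- The evaluations at `x` of the monomials spanning the polynomials of degree at most two. -/
def quadFeature {n : ℕ} (x : Fin n → ZMod 2) : Option (Fin n × Fin n) → ZMod 2
  | none => 1
  | some p => x p.1 * x p.2

/-- `S` is the support of a word of the dual code of `RM(2,n)`. -/
def IsDual {n : ℕ} (S : Finset (Fin n → ZMod 2)) : Prop :=
  ∑ x ∈ S, quadFeature x = 0

instance {n : ℕ} (S : Finset (Fin n → ZMod 2)) : Decidable (IsDual S) :=
  inferInstanceAs (Decidable (_ = _))

/-- The number of points of `S` off the hyperplane `u ⬝ᵥ x = 0`. -/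
def offCount {n : ℕ} (S : Finset (Fin n → ZMod 2)) (u : Fin n → ZMod 2) : ℕ :=
  (S.filter fun x => u ⬝ᵥ x = 1).card

/-- The Fourier transform of the indicator function of `S`. -/
def hat {n : ℕ} (S : Finset (Fin n → ZMod 2)) (u : Fin n → ZMod 2) : ℚ :=
  ∑ x ∈ S, sgn (u ⬝ᵥ x)

lemma sum_eq_card_filter {α : Type*} (S : Finset α) (p : α → ZMod 2) :
    ∑ x ∈ S, p x = ((S.filter fun x => p x = 1).card : ZMod 2) := by
  rw [← Finset.sum_boole]
  refine Finset.sum_congr rfl fun x _ => ?_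
  rcases zmod_two_cases (p x) with h | h <;> simp [h]

section Fourier

variable {n : ℕ} (S : Finset (Fin n → ZMod 2))

lemma hat_eq (u : Fin n → ZMod 2) : hat S u = S.card - 2 * offCount S u := by
  unfold hat offCount
  rw [Finset.card_filter, Finset.card_eq_sum_ones]
  push_cast
  rw [Finset.mul_sum, ← Finset.sum_sub_distrib]
  refine Finset.sum_congr rfl fun x _ => ?_
  rcases zmod_two_cases (u ⬝ᵥ x) with h | h <;> norm_num [h, sgn]

lemma add_eq_zero_iff_eq_two (x y : Fin n → ZMod 2) : x + y = 0 ↔ x = y := by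
  constructor
  · intro h
    have : x + y + y = y := by rw [h, zero_add]
    rwa [add_assoc, ZModModule.add_self, add_zero] at this
  · rintro rfl; exact ZModModule.add_self x

lemma add_add_cancel_two (x y : Fin n → ZMod 2) : x + y + y = x := by
  rw [add_assoc, ZModModule.add_self, add_zero]

lemma sum_hat_mul_sgn (a : Fin n → ZMod 2) :
    ∑ u, hat S u * sgn (u ⬝ᵥ a) = if a ∈ S then 2 ^ n else 0 := by
  unfold hat
  simp only [Finset.sum_mul, ← sgn_add, ← dotProduct_add]
  rw [Finset.sum_comm]
  simp only [sum_sgn_dotProduct, add_eq_zero_iff_eq_two, Fintype.card_fin]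
  simp

lemma sum_hat_sq : ∑ u, hat S u ^ 2 = 2 ^ n * S.card := by
  have h (u : Fin n → ZMod 2) : hat S u ^ 2 = ∑ a ∈ S, hat S u * sgn (u ⬝ᵥ a) := by
    rw [sq, ← Finset.mul_sum]; rfl
  simp only [h]
  rw [Finset.sum_comm]
  simp only [sum_hat_mul_sgn]
  rw [Finset.sum_ite_of_true fun a ha => ha]
  simp [mul_comm]

lemma add_mem_of_hat {a : Fin n → ZMod 2} (h : ∀ u, u ⬝ᵥ a = 1 → hat S u = 0) :
    ∀ x ∈ S, x + a ∈ S := by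
  intro x hx
  by_contra hxa
  have h1 := sum_hat_mul_sgn S (x + a)
  have h2 := sum_hat_mul_sgn S x
  rw [if_neg hxa] at h1
  rw [if_pos hx] at h2
  have h3 : ∑ u, hat S u * sgn (u ⬝ᵥ (x + a)) = ∑ u, hat S u * sgn (u ⬝ᵥ x) := by
    refine Finset.sum_congr rfl fun u _ => ?_
    rw [dotProduct_add, sgn_add]
    rcases zmod_two_cases (u ⬝ᵥ a) with hu | hu
    · rw [hu, sgn_zero, mul_one]
    · rw [h u hu, zero_mul, zero_mul]
  rw [h1, h2] at h3
  exact absurd h3.symm (by positivity)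

variable {S} in
lemma hat_eq_zero_of_add_mem {a u : Fin n → ZMod 2} (h : ∀ x ∈ S, x + a ∈ S)
    (hu : u ⬝ᵥ a = 1) : hat S u = 0 := by
  have h1 : hat S u = -hat S u := by
    unfold hat
    rw [← Finset.sum_neg_distrib]
    refine Finset.sum_bij' (fun x _ => x + a) (fun x _ => x + a) h h ?_ ?_ ?_
    · exact fun x _ => add_add_cancel_two x a
    · exact fun x _ => add_add_cancel_two x a
    · intro x _
      rw [dotProduct_add, hu, sgn_add, sgn_one]; ring
  linarith

end Fourier

lemma offCount_le {n : ℕ} (S : Finset (Fin n → ZMod 2)) (u : Fin n → ZMod 2) :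
    offCount S u ≤ S.card :=
  Finset.card_filter_le _ _

namespace IsDual

variable {n : ℕ} {S : Finset (Fin n → ZMod 2)}

lemma sum_mul (hS : IsDual S) (i j : Fin n) : ∑ x ∈ S, x i * x j = 0 := by
  simpa [quadFeature] using congrFun hS (some (i, j))

lemma even_card (hS : IsDual S) : Even S.card := by
  have h : ∑ x ∈ S, (1 : ZMod 2) = 0 := by simpa [quadFeature] using congrFun hS none
  rw [Finset.sum_const, nsmul_eq_mul, mul_one] at h
  exact (ZMod.natCast_eq_zero_iff_even).mp h

lemma sum_dotProduct_mul (hS : IsDual S) (u : Fin n → ZMod 2) (j : Fin n) :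
    ∑ x ∈ S, (u ⬝ᵥ x) * x j = 0 := by
  simp only [dotProduct, Finset.sum_mul, mul_assoc]
  rw [Finset.sum_comm]
  simp only [← Finset.mul_sum, hS.sum_mul, mul_zero, Finset.sum_const_zero]

lemma sum_dotProduct_mul_dotProduct (hS : IsDual S) (u v : Fin n → ZMod 2) :
    ∑ x ∈ S, (u ⬝ᵥ x) * (v ⬝ᵥ x) = 0 := by
  have h (x : Fin n → ZMod 2) : (u ⬝ᵥ x) * (v ⬝ᵥ x) = ∑ j, v j * ((u ⬝ᵥ x) * x j) := by
    rw [mul_comm, dotProduct, Finset.sum_mul]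
    exact Finset.sum_congr rfl fun j _ => by ring
  simp only [h]
  rw [Finset.sum_comm]
  simp only [← Finset.mul_sum, hS.sum_dotProduct_mul, mul_zero, Finset.sum_const_zero]

lemma sum_apply (hS : IsDual S) (j : Fin n) : ∑ x ∈ S, x j = 0 := by
  rw [← hS.sum_mul j j]
  refine Finset.sum_congr rfl fun x _ => ?_
  rcases zmod_two_cases (x j) with h | h <;> simp [h]

lemma even_offCount (hS : IsDual S) (u : Fin n → ZMod 2) : Even (offCount S u) := by
  have h := hS.sum_dotProduct_mul_dotProduct u u
  rw [sum_eq_card_filter, ZMod.natCast_eq_zero_iff_even] at h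
  unfold offCount
  convert h using 4 with x
  rcases zmod_two_cases (u ⬝ᵥ x) with h | h <;> simp [h]

end IsDual

lemma card_ne_two_of_sum_eq_zero {n : ℕ} {T : Finset (Fin n → ZMod 2)}
    (h : ∀ j, ∑ x ∈ T, x j = 0) : T.card ≠ 2 := by
  intro hT
  obtain ⟨x, y, hxy, rfl⟩ := Finset.card_eq_two.mp hT
  refine hxy ((add_eq_zero_iff_eq_two x y).mp ?_)
  funext j
  simpa [Finset.sum_pair hxy] using h j

namespace IsDual

variable {n : ℕ} {S : Finset (Fin n → ZMod 2)}

lemma offCount_ne_two (hS : IsDual S) (u : Fin n → ZMod 2) : offCount S u ≠ 2 := by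
  refine card_ne_two_of_sum_eq_zero fun j => ?_
  rw [Finset.sum_filter]
  refine Eq.trans ?_ (hS.sum_dotProduct_mul u j)
  refine Finset.sum_congr rfl fun x _ => ?_
  rcases zmod_two_cases (u ⬝ᵥ x) with h | h <;> simp [h]

lemma offCount_add_two_ne (hS : IsDual S) (u : Fin n → ZMod 2) : offCount S u + 2 ≠ S.card := by
  intro hc
  have h1 : (S.filter fun x => ¬ u ⬝ᵥ x = 1).card ≠ 2 := by
    refine card_ne_two_of_sum_eq_zero fun j => ?_
    have h0 : ∑ x ∈ S, (1 + u ⬝ᵥ x) * x j = 0 := by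
      simp only [add_mul, one_mul, Finset.sum_add_distrib, hS.sum_dotProduct_mul, hS.sum_apply,
        add_zero]
    rw [Finset.sum_filter]
    refine Eq.trans ?_ h0
    refine Finset.sum_congr rfl fun x _ => ?_
    have h11 : (1 + 1 : ZMod 2) = 0 := by decide
    rcases zmod_two_cases (u ⬝ᵥ x) with h | h <;> simp [h, h11]
  have h2 := Finset.card_filter_add_card_filter_not (s := S) (fun x => u ⬝ᵥ x = 1)
  unfold offCount at hc
  omega

lemma offCount_add_mod (hS : IsDual S) (u v : Fin n → ZMod 2) :
    ∃ k, offCount S (u + v) + 4 * k = offCount S u + offCount S v := by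
  have h := hS.sum_dotProduct_mul_dotProduct u v
  rw [sum_eq_card_filter, ZMod.natCast_eq_zero_iff_even] at h
  obtain ⟨k, hk⟩ := h
  refine ⟨k, ?_⟩
  rw [show 4 * k = 2 * (k + k) by ring, ← hk]
  unfold offCount
  simp only [Finset.card_filter, Finset.mul_sum, ← Finset.sum_add_distrib]
  refine Finset.sum_congr rfl fun x _ => ?_
  have h11 : (1 + 1 : ZMod 2) = 0 := by decide
  rcases zmod_two_cases (u ⬝ᵥ x) with hu | hu <;> rcases zmod_two_cases (v ⬝ᵥ x) with hv | hv <;>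
    simp [hu, hv, add_dotProduct, h11]

/-- Half the section sizes are given modulo two by a linear functional. -/
lemma exists_offCount_mod_four (hS : IsDual S) :
    ∃ a : Fin n → ZMod 2, ∀ u, offCount S u % 4 = if u ⬝ᵥ a = 1 then 2 else 0 := by
  have key (u v : Fin n → ZMod 2) : ((offCount S (u + v) / 2 : ℕ) : ZMod 2) =
      (offCount S u / 2 : ℕ) + (offCount S v / 2 : ℕ) := by
    obtain ⟨k, hk⟩ := hS.offCount_add_mod u v
    have h1 := (hS.even_offCount u).two_dvd
    have h2 := (hS.even_offCount v).two_dvd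
    have h3 := (hS.even_offCount (u + v)).two_dvd
    rw [← Nat.cast_add, ZMod.natCast_eq_natCast_iff']
    omega
  let h : (Fin n → ZMod 2) →+ ZMod 2 := AddMonoidHom.mk' (fun u => (offCount S u / 2 : ℕ)) key
  refine ⟨fun i => h (Pi.single i 1), fun u => ?_⟩
  have hu : u ⬝ᵥ (fun i => h (Pi.single i 1)) = (offCount S u / 2 : ℕ) := by
    have := LinearMap.pi_apply_eq_sum_univ (h.toZModLinearMap 2) u
    simp only [AddMonoidHom.coe_toZModLinearMap, smul_eq_mul] at this
    change _ = h u
    rw [this, dotProduct]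
    refine Finset.sum_congr rfl fun i _ => ?_
    congr 2
    funext j
    simp [Pi.single_apply, eq_comm]
  rw [hu]
  have h1 := (hS.even_offCount u).two_dvd
  have h2 : ((offCount S u / 2 : ℕ) : ZMod 2) = 1 ↔ offCount S u / 2 % 2 = 1 := by
    rw [← Nat.cast_one, ZMod.natCast_eq_natCast_iff']
  simp only [h2]
  split_ifs <;> omega

end IsDual

section Words

variable {n : ℕ} {S : Finset (Fin n → ZMod 2)}

lemma card_eq_of_hat_sq_eq {m : ℕ} (hm : ∀ u, hat S u ^ 2 = m) : S.card = m := by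
  have h := sum_hat_sq S
  simp only [hm, Finset.sum_const, Finset.card_univ, Fintype.card_fun, ZMod.card,
    Fintype.card_fin, nsmul_eq_mul] at h
  push_cast at h
  have h2 : (2 : ℚ) ^ n ≠ 0 := by positivity
  exact_mod_cast (mul_left_cancel₀ h2 h).symm

lemma offCount_zero : offCount S 0 = 0 := by
  simp [offCount]

namespace IsDual

lemma card_ne_two (hS : IsDual S) : S.card ≠ 2 := by
  intro h
  exact hS.offCount_add_two_ne 0 (by rw [offCount_zero, h])

lemma card_ne_four_six (hS : IsDual S) (h : S.card = 4 ∨ S.card = 6) : False := by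
  have hc : ∀ u, offCount S u = 0 ∨ offCount S u = S.card := by
    intro u
    have h1 := (hS.even_offCount u).two_dvd
    have h2 := hS.offCount_ne_two u
    have h3 := hS.offCount_add_two_ne u
    have h4 := offCount_le S u
    omega
  have := card_eq_of_hat_sq_eq (S := S) (m := S.card ^ 2) fun u => by
    rw [hat_eq]
    rcases hc u with h | h <;> rw [h] <;> push_cast <;> ring
  rcases h with h | h <;> rw [h] at this <;> omega

lemma card_ne_ten (hS : IsDual S) : S.card ≠ 10 := by
  intro h
  obtain ⟨a, ha⟩ := hS.exists_offCount_mod_four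
  have hc : ∀ u, 2 ≤ hat S u * sgn (u ⬝ᵥ a) := by
    intro u
    have h1 := ha u
    have h2 := hS.offCount_ne_two u
    have h3 := hS.offCount_add_two_ne u
    have h4 := offCount_le S u
    rw [hat_eq]
    rcases zmod_two_cases (u ⬝ᵥ a) with hu | hu
    · rw [hu, if_neg (by decide)] at h1
      have h5 : offCount S u = 0 ∨ offCount S u = 4 := by omega
      rcases h5 with h5 | h5 <;> rw [h5, h, hu, sgn_zero] <;> norm_num
    · rw [hu, if_pos rfl] at h1
      have h5 : offCount S u = 6 ∨ offCount S u = 10 := by omega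
      rcases h5 with h5 | h5 <;> rw [h5, h, hu, sgn_one] <;> norm_num
  have h1 := Finset.sum_le_sum fun u (_ : u ∈ Finset.univ) => hc u
  rw [sum_hat_mul_sgn] at h1
  simp only [Finset.sum_const, Finset.card_univ, Fintype.card_fun, ZMod.card,
    Fintype.card_fin, nsmul_eq_mul] at h1
  push_cast at h1
  have h2 : (0 : ℚ) < 2 ^ n := by positivity
  split_ifs at h1 <;> linarith

/-- A dual word of weight eight is a three-dimensional flat. -/
lemma card_periods_of_card_eq_eight (hS : IsDual S) (h : S.card = 8) :
    (Finset.univ.filter fun a => a ≠ 0 ∧ ∀ x ∈ S, x + a ∈ S).card = 7 := by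
  obtain ⟨x₀, hx₀⟩ : S.Nonempty := by rw [← Finset.card_pos]; omega
  have h1 : Finset.univ.filter (fun a => a ≠ 0 ∧ ∀ x ∈ S, x + a ∈ S) =
      (S.erase x₀).image (x₀ + ·) := by
    ext a
    simp only [Finset.mem_filter, Finset.mem_univ, true_and, Finset.mem_image, Finset.mem_erase]
    constructor
    · rintro ⟨ha, h1⟩
      refine ⟨x₀ + a, ⟨by simpa using ha, h1 x₀ hx₀⟩, ?_⟩
      rw [← add_assoc, ZModModule.add_self, zero_add]
    · rintro ⟨y, ⟨hy, hyS⟩, rfl⟩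
      refine ⟨fun h0 => hy ((add_eq_zero_iff_eq_two _ _).mp h0).symm, ?_⟩
      refine add_mem_of_hat S fun u hu => ?_
      have h1 := (hS.even_offCount u).two_dvd
      have h2 := hS.offCount_ne_two u
      have h3 := hS.offCount_add_two_ne u
      have h4 := offCount_le S u
      have h5 : offCount S u ≠ 0 := by
        intro h0
        have h6 : ∀ z ∈ S, u ⬝ᵥ z = 0 := fun z hz => (zmod_two_cases _).resolve_right
          (Finset.filter_eq_empty_iff.mp (Finset.card_eq_zero.mp h0) hz)
        rw [dotProduct_add, h6 _ hx₀, h6 _ hyS] at hu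
        exact absurd hu (by decide)
      have h7 : offCount S u ≠ S.card := by
        intro h0
        have h6 : ∀ z ∈ S, u ⬝ᵥ z = 1 := Finset.card_filter_eq_iff.mp h0
        rw [dotProduct_add, h6 _ hx₀, h6 _ hyS] at hu
        exact absurd hu (by decide)
      have h8 : offCount S u = 4 := by omega
      rw [hat_eq, h, h8]; norm_num
  rw [h1, Finset.card_image_of_injective _ (add_right_injective x₀), Finset.card_erase_of_mem hx₀, h]

end IsDual

lemma exists_dotProduct_eq_one_zero {a b : Fin n → ZMod 2} (ha : a ≠ 0) (hab : a ≠ b) :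
    ∃ u : Fin n → ZMod 2, u ⬝ᵥ a = 1 ∧ u ⬝ᵥ b = 0 := by
  have h11 : (1 + 1 : ZMod 2) = 0 := by decide
  obtain ⟨i, hi⟩ := Function.ne_iff.mp hab
  obtain ⟨j, hj⟩ := Function.ne_iff.mp ha
  have hj : a j = 1 := (zmod_two_cases _).resolve_left hj
  rcases zmod_two_cases (a i) with h1 | h1 <;> rcases zmod_two_cases (b i) with h2 | h2 <;>
    rw [h1, h2] at hi
  · exact absurd rfl hi
  · rcases zmod_two_cases (b j) with h3 | h3
    · exact ⟨Pi.single j 1, by simp [hj], by simp [h3]⟩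
    · exact ⟨Pi.single i 1 + Pi.single j 1, by simp [add_dotProduct, h1, hj],
        by simp [add_dotProduct, h2, h3, h11]⟩
  · exact ⟨Pi.single i 1, by simp [h1], by simp [h2]⟩
  · exact absurd rfl hi

/-- A dual word of weight twelve is invariant under exactly one nonzero translation. -/
lemma IsDual.card_periods_of_card_eq_twelve (hS : IsDual S) (h : S.card = 12) :
    (Finset.univ.filter fun a => a ≠ 0 ∧ ∀ x ∈ S, x + a ∈ S).card = 1 := by
  obtain ⟨a, ha⟩ := hS.exists_offCount_mod_four
  rw [Finset.card_eq_one]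
  refine ⟨a, ?_⟩
  ext b
  simp only [Finset.mem_filter, Finset.mem_univ, true_and, Finset.mem_singleton]
  constructor
  · rintro ⟨hb, hbS⟩
    by_contra hba
    obtain ⟨u, hu, hu'⟩ := exists_dotProduct_eq_one_zero hb hba
    have h1 := hat_eq_zero_of_add_mem hbS hu
    rw [hat_eq, h] at h1
    have h2 : offCount S u = 6 := by
      have : (offCount S u : ℚ) = 6 := by push_cast at h1; linarith
      exact_mod_cast this
    have h3 := ha u
    rw [hu', if_neg (by decide), h2] at h3
    omega
  · rintro rfl
    constructor
    · rintro rfl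
      have h1 : ∀ u, 16 ≤ hat S u ^ 2 := by
        intro u
        have h1 := ha u
        rw [dotProduct_zero, if_neg (by decide)] at h1
        have h4 := offCount_le S u
        rw [hat_eq, h]
        have h5 : offCount S u = 0 ∨ offCount S u = 4 ∨ offCount S u = 8 ∨ offCount S u = 12 := by
          omega
        rcases h5 with h5 | h5 | h5 | h5 <;> rw [h5] <;> norm_num
      have h2 := Finset.sum_le_sum fun u (_ : u ∈ Finset.univ) => h1 u
      rw [sum_hat_sq, h] at h2
      simp only [Finset.sum_const, Finset.card_univ, Fintype.card_fun, ZMod.card,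
        Fintype.card_fin, nsmul_eq_mul] at h2
      push_cast at h2
      have h3 : (0 : ℚ) < 2 ^ n := by positivity
      linarith
    · refine add_mem_of_hat S fun u hu => ?_
      have h1 := ha u
      have h2 := hS.offCount_ne_two u
      have h3 := hS.offCount_add_two_ne u
      have h4 := offCount_le S u
      rw [if_pos hu] at h1
      have h5 : offCount S u = 6 := by omega
      rw [hat_eq, h, h5]; norm_num

end Words

section Pairs

variable {n : ℕ}

/-- The union of `A` with its translate by `a`. -/
def translateUnion (a : Fin n → ZMod 2) (A : Finset (Fin n → ZMod 2)) :
    Finset (Fin n → ZMod 2) :=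
  A ∪ A.image (· + a)

variable {a : Fin n → ZMod 2} {i : Fin n} {A S : Finset (Fin n → ZMod 2)}

lemma disjoint_image_add (ha : a i = 1) (hA : ∀ x ∈ A, x i = 0) :
    Disjoint A (A.image (· + a)) := by
  rw [Finset.disjoint_left]
  intro x hx hx'
  obtain ⟨y, hy, rfl⟩ := Finset.mem_image.mp hx'
  have h := hA _ hx
  rw [Pi.add_apply, hA y hy, ha] at h
  exact absurd h (by decide)

lemma sum_translateUnion {M : Type*} [AddCommMonoid M] (ha : a i = 1) (hA : ∀ x ∈ A, x i = 0)
    (F : (Fin n → ZMod 2) → M) :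
    ∑ x ∈ translateUnion a A, F x = ∑ x ∈ A, (F x + F (x + a)) := by
  rw [translateUnion, Finset.sum_union (disjoint_image_add ha hA),
    Finset.sum_image fun x _ y _ h => add_left_injective a h, Finset.sum_add_distrib]

lemma prod_translateUnion (ha : a i = 1) (hA : ∀ x ∈ A, x i = 0)
    (F : (Fin n → ZMod 2) → ℚ) :
    ∏ x ∈ translateUnion a A, F x = ∏ x ∈ A, (F x * F (x + a)) := by
  rw [translateUnion, Finset.prod_union (disjoint_image_add ha hA),
    Finset.prod_image fun x _ y _ h => add_left_injective a h, Finset.prod_mul_distrib]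

lemma card_translateUnion (ha : a i = 1) (hA : ∀ x ∈ A, x i = 0) :
    (translateUnion a A).card = 2 * A.card := by
  rw [translateUnion, Finset.card_union_of_disjoint (disjoint_image_add ha hA),
    Finset.card_image_of_injective _ (add_left_injective a), two_mul]

lemma filter_translateUnion (ha : a i = 1) (hA : ∀ x ∈ A, x i = 0) :
    (translateUnion a A).filter (fun x => x i = 0) = A := by
  ext x
  simp only [translateUnion, Finset.mem_filter, Finset.mem_union, Finset.mem_image]
  constructor
  · rintro ⟨h | ⟨y, hy, rfl⟩, hx⟩
    · exact h
    · rw [Pi.add_apply, hA y hy, ha] at hx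
      exact absurd hx (by decide)
  · exact fun h => ⟨Or.inl h, hA x h⟩

lemma translateUnion_filter (ha : a i = 1) (hS : ∀ x ∈ S, x + a ∈ S) :
    translateUnion a (S.filter fun x => x i = 0) = S := by
  ext x
  simp only [translateUnion, Finset.mem_filter, Finset.mem_union, Finset.mem_image]
  constructor
  · rintro (⟨h, -⟩ | ⟨y, ⟨hy, -⟩, rfl⟩)
    · exact h
    · exact hS y hy
  · intro h
    rcases zmod_two_cases (x i) with hx | hx
    · exact Or.inl ⟨h, hx⟩
    · refine Or.inr ⟨x + a, ⟨hS x h, ?_⟩, add_add_cancel_two x a⟩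
      rw [Pi.add_apply, hx, ha]; decide

lemma add_mem_translateUnion : ∀ x ∈ translateUnion a A, x + a ∈ translateUnion a A := by
  intro x hx
  simp only [translateUnion, Finset.mem_union, Finset.mem_image] at hx ⊢
  rcases hx with h | ⟨y, hy, rfl⟩
  · exact Or.inr ⟨x, h, rfl⟩
  · exact Or.inl (by rwa [add_add_cancel_two])

lemma isDual_translateUnion_iff (ha : a i = 1) (hA : ∀ x ∈ A, x i = 0) (hc : Even A.card) :
    IsDual (translateUnion a A) ↔ ∑ x ∈ A, x = 0 := by
  have hc' : (A.card : ZMod 2) = 0 := ZMod.natCast_eq_zero_iff_even.mpr hc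
  have hquad (j k : Fin n) : ∑ x ∈ A, (quadFeature x + quadFeature (x + a)) (some (j, k)) =
      (∑ x ∈ A, x j) * a k + a j * ∑ x ∈ A, x k := by
    have h (x : Fin n → ZMod 2) : (quadFeature x + quadFeature (x + a)) (some (j, k)) =
        x j * a k + a j * x k + a j * a k := by
      simp only [Pi.add_apply, quadFeature]
      linear_combination ZModModule.add_self (x j * x k)
    simp only [h, Finset.sum_add_distrib, Finset.sum_const, nsmul_eq_mul, hc', zero_mul,
      add_zero, Finset.sum_mul, Finset.mul_sum]
  rw [IsDual, sum_translateUnion ha hA]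
  constructor
  · intro h
    funext j
    have h1 := congrFun h (some (j, i))
    rw [Finset.sum_apply, hquad, ha, mul_one, Finset.sum_eq_zero hA, mul_zero, add_zero] at h1
    rw [Finset.sum_apply, h1]; rfl
  · intro h
    have h1 (j : Fin n) : ∑ x ∈ A, x j = 0 := by
      rw [← Finset.sum_apply, h]; rfl
    funext p
    rw [Finset.sum_apply]
    rcases p with _ | ⟨j, k⟩
    · have h11 : (1 + 1 : ZMod 2) = 0 := by decide
      simp [quadFeature, h11]
    · rw [hquad, h1, h1]; simp

/-- Sets of pairs `{x, x + a}` whose sum vanishes modulo `a` correspond to the dual words that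
are invariant under translation by `a`. -/
lemma sum_pairs_eq_sum_isDual (ha : a i = 1) {j : ℕ} (hj : Even j)
    (s : (Fin n → ZMod 2) → ℚ) :
    ∑ A ∈ ((Finset.univ.filter fun x : Fin n → ZMod 2 => x i = 0).powersetCard j).filter
        (fun A => ∑ x ∈ A, x = 0), ∏ x ∈ A, (s x * s (x + a)) =
      ∑ S ∈ ((Finset.univ : Finset (Fin n → ZMod 2)).powersetCard (2 * j)).filter IsDual,
        if ∀ x ∈ S, x + a ∈ S then ∏ x ∈ S, s x else 0 := by
  rw [← Finset.sum_filter]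
  refine Finset.sum_bij' (fun A _ => translateUnion a A) (fun S _ => S.filter fun x => x i = 0)
    ?_ ?_ ?_ ?_ ?_
  · intro A h
    simp only [Finset.mem_filter, Finset.mem_powersetCard, Finset.subset_iff, Finset.mem_univ,
      true_and] at h
    obtain ⟨⟨hA, hc⟩, h0⟩ := h
    simp only [Finset.mem_filter, Finset.mem_powersetCard, Finset.subset_univ, true_and,
      card_translateUnion ha hA, hc, isDual_translateUnion_iff ha hA (hc ▸ hj), h0]
    exact add_mem_translateUnion
  · intro S h
    simp only [Finset.mem_filter, Finset.mem_powersetCard, Finset.subset_univ, true_and] at h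
    obtain ⟨⟨hc, hd⟩, hinv⟩ := h
    have hA : ∀ x ∈ S.filter (fun x => x i = 0), x i = 0 := fun x hx => (Finset.mem_filter.mp hx).2
    have h1 := card_translateUnion ha hA
    rw [translateUnion_filter ha hinv, hc] at h1
    have h2 : (S.filter fun x => x i = 0).card = j := by omega
    rw [← translateUnion_filter ha hinv, isDual_translateUnion_iff ha hA (h2 ▸ hj)] at hd
    simp only [Finset.mem_filter, Finset.mem_powersetCard]
    exact ⟨⟨fun x hx => by simpa using hA x hx, h2⟩, hd⟩
  · intro A h
    simp only [Finset.mem_filter, Finset.mem_powersetCard, Finset.subset_iff, Finset.mem_univ,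
      true_and] at h
    exact filter_translateUnion ha h.1.1
  · intro S h
    exact translateUnion_filter ha (Finset.mem_filter.mp h).2
  · intro A h
    simp only [Finset.mem_filter, Finset.mem_powersetCard, Finset.subset_iff, Finset.mem_univ,
      true_and] at h
    exact (prod_translateUnion ha h.1.1 s).symm

end Pairs

/-- The signed number of dual words of weight `k`. -/
def dualSum {n : ℕ} (s : (Fin n → ZMod 2) → ℚ) (k : ℕ) : ℚ :=
  ∑ S ∈ ((Finset.univ : Finset (Fin n → ZMod 2)).powersetCard k).filter IsDual, ∏ x ∈ S, s x

/-- The signed number of dual words of weight `k` that are invariant under translation by `a`. -/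
def dualSumAt {n : ℕ} (s : (Fin n → ZMod 2) → ℚ) (a : Fin n → ZMod 2) (k : ℕ) : ℚ :=
  ∑ S ∈ ((Finset.univ : Finset (Fin n → ZMod 2)).powersetCard k).filter IsDual,
    if ∀ x ∈ S, x + a ∈ S then ∏ x ∈ S, s x else 0

section DualSum

variable {n : ℕ} (s : (Fin n → ZMod 2) → ℚ)

lemma dualSum_eq_zero {k : ℕ} (h : ∀ S : Finset (Fin n → ZMod 2), IsDual S → S.card ≠ k) :
    dualSum s k = 0 := by
  refine Finset.sum_eq_zero fun S hS => ?_
  simp only [Finset.mem_filter, Finset.mem_powersetCard] at hS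
  exact absurd hS.1.2 (h S hS.2)

lemma dualSumAt_eq_zero {k : ℕ} (h : ∀ S : Finset (Fin n → ZMod 2), IsDual S → S.card ≠ k)
    (a : Fin n → ZMod 2) : dualSumAt s a k = 0 := by
  refine Finset.sum_eq_zero fun S hS => ?_
  simp only [Finset.mem_filter, Finset.mem_powersetCard] at hS
  exact absurd hS.1.2 (h S hS.2)

lemma dualSum_zero : dualSum s 0 = 1 := by
  have h : IsDual (∅ : Finset (Fin n → ZMod 2)) := Finset.sum_empty
  rw [dualSum, Finset.powersetCard_zero, Finset.filter_singleton, if_pos h]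
  simp

lemma sum_dualSumAt {k m : ℕ} (h : ∀ S : Finset (Fin n → ZMod 2), IsDual S → S.card = k →
    (Finset.univ.filter fun a => a ≠ 0 ∧ ∀ x ∈ S, x + a ∈ S).card = m) :
    ∑ a ∈ Finset.univ.filter (fun a : Fin n → ZMod 2 => a ≠ 0), dualSumAt s a k =
      m * dualSum s k := by
  unfold dualSumAt dualSum
  rw [Finset.sum_comm, Finset.mul_sum]
  refine Finset.sum_congr rfl fun S hS => ?_
  simp only [Finset.mem_filter, Finset.mem_powersetCard] at hS
  rw [← Finset.sum_filter, Finset.sum_const, Finset.filter_filter, h S hS.2 hS.1.2, nsmul_eq_mul]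

lemma sum_elemSymm_quadFeature (k : ℕ) :
    ∑ w, elemSymm Finset.univ (fun x => s x * sgn (w ⬝ᵥ quadFeature x)) k =
      2 ^ Fintype.card (Option (Fin n × Fin n)) * dualSum s k :=
  sum_elemSymm quadFeature Finset.univ s k

lemma sum_elemSymm_pairs {a : Fin n → ZMod 2} {i : Fin n} (ha : a i = 1) {j : ℕ} (hj : Even j) :
    ∑ w : Fin n → ZMod 2, elemSymm (Finset.univ.filter fun x : Fin n → ZMod 2 => x i = 0)
      (fun x => s x * s (x + a) * sgn (w ⬝ᵥ x)) j = 2 ^ n * dualSumAt s a (2 * j) := by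
  rw [sum_elemSymm (fun x => x), Fintype.card_fin, sum_pairs_eq_sum_isDual ha hj, dualSumAt]

end DualSum

lemma dotProduct_quadFeature_mem_RM {n : ℕ} (w : Option (Fin n × Fin n) → ZMod 2) :
    (fun x => w ⬝ᵥ quadFeature x) ∈ RM 2 n := by
  refine ⟨MvPolynomial.C (w none) + ∑ p : Fin n × Fin n,
    MvPolynomial.C (w (some p)) * (MvPolynomial.X p.1 * MvPolynomial.X p.2), ?_, fun x => ?_⟩
  · refine (MvPolynomial.totalDegree_add _ _).trans (max_le ?_ ?_)
    · simp
    · refine MvPolynomial.totalDegree_finsetSum_le fun p _ => ?_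
      refine (MvPolynomial.totalDegree_mul _ _).trans ?_
      refine (Nat.add_le_add_left (MvPolynomial.totalDegree_mul _ _) _).trans ?_
      simp [MvPolynomial.totalDegree_X]
  · simp [dotProduct, Fintype.sum_option, quadFeature]

lemma sum_sgn_eq_hd {n : ℕ} (f g : BF n) :
    ∑ x, sgn (f x) * sgn (g x) = 2 ^ n - 2 * hd f g := by
  have h (x : Fin n → ZMod 2) :
      sgn (f x) * sgn (g x) = 1 - 2 * if f x ≠ g x then 1 else 0 := by
    rcases zmod_two_cases (f x) with hf | hf <;> rcases zmod_two_cases (g x) with hg | hg <;>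
      norm_num [hf, hg, sgn]
  simp only [h, Finset.sum_sub_distrib, ← Finset.mul_sum, hd, Finset.card_filter]
  simp

lemma hd_add_one {n : ℕ} (f g : BF n) : hd f g + hd f (fun x => g x + 1) = 2 ^ n := by
  have h1 := sum_sgn_eq_hd f g
  have h2 := sum_sgn_eq_hd f (fun x => g x + 1)
  simp only [sgn_add, sgn_one, mul_neg, mul_one, Finset.sum_neg_distrib, h1] at h2
  have h : ((hd f g + hd f (fun x => g x + 1) : ℕ) : ℚ) = (2 ^ n : ℕ) := by
    push_cast; linarith
  exact_mod_cast h

/-- Expansion of the test polynomial in Krawtchouk polynomials of length 512. -/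
lemma test_polynomial_eq {α : Type*} [DecidableEq α] (A : Finset α) (hA : A.card = 512)
    (s : α → ℚ) (hs : ∀ x, s x * s x = 1) :
    ((∑ x ∈ A, s x) ^ 2 - 6084) * ((∑ x ∈ A, s x) ^ 3 * ((∑ x ∈ A, s x) ^ 2 - 2048)) ^ 2 =
      479001600 * elemSymm A s 12 + 84086553600 * elemSymm A s 10 +
      7165947801600 * elemSymm A s 8 + 392814911738880 * elemSymm A s 6 +
      15338939063479296 * elemSymm A s 4 + 430599975017093120 * elemSymm A s 2 +
      6804370111566970880 * elemSymm A s 0 := by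
  have hrec (k : ℕ) : elemSymm A s (k + 2) =
      ((∑ x ∈ A, s x) * elemSymm A s (k + 1) - (512 - k) * elemSymm A s k) / (k + 2) := by
    rw [eq_div_iff (by positivity), mul_comm, elemSymm_add_two A s hs, hA]
    norm_num
  have h1 := elemSymm_one A s
  have h0 := elemSymm_zero A s
  have h2 := hrec 0
  have h3 := hrec 1
  have h4 := hrec 2
  have h5 := hrec 3
  have h6 := hrec 4
  have h7 := hrec 5
  have h8 := hrec 6
  have h9 := hrec 7
  have h10 := hrec 8
  have h11 := hrec 9
  have h12 := hrec 10
  generalize ∑ x ∈ A, s x = W at *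
  norm_num only [h0, h1] at h2
  norm_num only [h1, h2] at h3
  norm_num only [h2, h3] at h4
  norm_num only [h3, h4] at h5
  norm_num only [h4, h5] at h6
  norm_num only [h5, h6] at h7
  norm_num only [h6, h7] at h8
  norm_num only [h7, h8] at h9
  norm_num only [h8, h9] at h10
  norm_num only [h9, h10] at h11
  norm_num only [h10, h11] at h12
  rw [h12, h10, h8, h6, h4, h2, h0]
  ring

/-- Positivity of the combination of Krawtchouk polynomials of length 256 that the derivatives
contribute. -/
lemma derivative_polynomial_pos {α : Type*} [DecidableEq α] (A : Finset α) (hA : A.card = 256)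
    (s : α → ℚ) (hs : ∀ x, s x * s x = 1) :
    0 < 6804370111566970880 / 511 * elemSymm A s 0 + 10 ^ 14 * elemSymm A s 2 +
      7165947801600 / 7 * elemSymm A s 4 + 479001600 * elemSymm A s 6 := by
  have hrec (k : ℕ) : elemSymm A s (k + 2) =
      ((∑ x ∈ A, s x) * elemSymm A s (k + 1) - (256 - k) * elemSymm A s k) / (k + 2) := by
    rw [eq_div_iff (by positivity), mul_comm, elemSymm_add_two A s hs, hA]
    norm_num
  have h1 := elemSymm_one A s
  have h0 := elemSymm_zero A s
  have h2 := hrec 0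
  have h3 := hrec 1
  have h4 := hrec 2
  have h5 := hrec 3
  have h6 := hrec 4
  generalize ∑ x ∈ A, s x = W at *
  norm_num only [h0, h1] at h2
  norm_num only [h1, h2] at h3
  norm_num only [h2, h3] at h4
  norm_num only [h3, h4] at h5
  norm_num only [h4, h5] at h6
  rw [h6, h4, h2, h0]
  have hu : 0 ≤ W ^ 2 := sq_nonneg W
  have hu3 : 0 ≤ (W ^ 2) ^ 3 := by positivity
  have hsq := sq_nonneg (W ^ 2 - 166)
  ring_nf at *
  linarith

/-- For every `f ∈ B_9`, `nl_2(f) ≤ 216`. -/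
theorem stmt2 : ∀ f : BF 9, nl 2 f ≤ 216 := by
  intro f
  by_contra hf
  have hd_ge : ∀ g ∈ RM 2 9, 217 ≤ hd f g := fun g hg => by
    have h : nl 2 f ≤ hd f g := Nat.sInf_le ⟨g, hg, rfl⟩
    omega
  set s : (Fin 9 → ZMod 2) → ℚ := fun x => sgn (f x) with hs_def
  have hs : ∀ x, s x * s x = 1 := fun x => sgn_mul_self _
  have htwist {α : Type} (t : α → ℚ) (ht : ∀ x, t x * t x = 1) (y : α → ZMod 2) :
      ∀ x, (t x * sgn (y x)) * (t x * sgn (y x)) = 1 := fun x => by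
    rw [mul_mul_mul_comm, ht, sgn_mul_self, one_mul]
  have hcard : (Finset.univ : Finset (Fin 9 → ZMod 2)).card = 512 := by
    simp [Finset.card_univ]
  -- every quadratic function has a small correlation with `f`
  have hW (w : Option (Fin 9 × Fin 9) → ZMod 2) :
      (∑ x, s x * sgn (w ⬝ᵥ quadFeature x)) ^ 2 ≤ 6084 := by
    have h1 := hd_ge _ (dotProduct_quadFeature_mem_RM w)
    have h2 : 217 ≤ hd f (fun x => w ⬝ᵥ quadFeature x + 1) := by
      obtain ⟨p, hp, hpe⟩ := dotProduct_quadFeature_mem_RM w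
      refine hd_ge _ ⟨p + MvPolynomial.C 1, ?_, fun x => by simp [← hpe]⟩
      exact (MvPolynomial.totalDegree_add _ _).trans (max_le hp (by simp))
    have h3 := hd_add_one f (fun x => w ⬝ᵥ quadFeature x)
    rw [sum_sgn_eq_hd f (fun x => w ⬝ᵥ quadFeature x)]
    generalize hd f (fun x => w ⬝ᵥ quadFeature x) = d at *
    have h4 : d ≤ 295 := by omega
    have h5 : (217 : ℚ) ≤ d := by exact_mod_cast h1
    have h6 : (d : ℚ) ≤ 295 := by exact_mod_cast h4
    rw [show (6084 : ℚ) = 78 ^ 2 by norm_num, show (2 : ℚ) ^ 9 = 512 by norm_num]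
    exact sq_le_sq' (by linarith) (by linarith)
  have hneg : ∑ w, ((∑ x, s x * sgn (w ⬝ᵥ quadFeature x)) ^ 2 - 6084) *
      ((∑ x, s x * sgn (w ⬝ᵥ quadFeature x)) ^ 3 *
        ((∑ x, s x * sgn (w ⬝ᵥ quadFeature x)) ^ 2 - 2048)) ^ 2 ≤ 0 := by
    refine Finset.sum_nonpos fun w _ => ?_
    have h := hW w
    generalize ∑ x, s x * sgn (w ⬝ᵥ quadFeature x) = W at h ⊢
    exact mul_nonpos_of_nonpos_of_nonneg (sub_nonpos.mpr h) (sq_nonneg _)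
  simp only [test_polynomial_eq Finset.univ hcard _ (htwist s hs _), Finset.sum_add_distrib,
    ← Finset.mul_sum, sum_elemSymm_quadFeature] at hneg
  rw [dualSum_zero, dualSum_eq_zero s fun S hS => hS.card_ne_ten,
    dualSum_eq_zero s fun S hS h => hS.card_ne_four_six (Or.inr h),
    dualSum_eq_zero s fun S hS h => hS.card_ne_four_six (Or.inl h),
    dualSum_eq_zero s fun S hS => hS.card_ne_two] at hneg
  have hneg' : 479001600 * dualSum s 12 + 7165947801600 * dualSum s 8 +
      6804370111566970880 ≤ 0 := by
    have h2 : (0 : ℚ) < 2 ^ Fintype.card (Option (Fin 9 × Fin 9)) := by positivity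
    refine nonpos_of_mul_nonpos_right ?_ h2
    linarith
  -- the contributions of the derivatives of `f`
  have hpos : ∀ a ∈ Finset.univ.filter (fun a : Fin 9 → ZMod 2 => a ≠ 0),
      0 < 6804370111566970880 / 511 + 7165947801600 / 7 * dualSumAt s a 8 +
        479001600 * dualSumAt s a 12 := by
    intro a ha
    obtain ⟨i, hi⟩ := Function.ne_iff.mp (Finset.mem_filter.mp ha).2
    have hi : a i = 1 := (zmod_two_cases _).resolve_left hi
    have hR : (Finset.univ.filter fun x : Fin 9 → ZMod 2 => x i = 0).card = 256 := by
      have h := card_translateUnion hi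
        (fun x hx => (Finset.mem_filter.mp hx).2 :
          ∀ x ∈ Finset.univ.filter (fun x : Fin 9 → ZMod 2 => x i = 0), x i = 0)
      rw [translateUnion_filter hi fun x _ => Finset.mem_univ _, hcard] at h
      omega
    have hss : ∀ x, (s x * s (x + a)) * (s x * s (x + a)) = 1 := fun x => by
      rw [mul_mul_mul_comm, hs, hs, one_mul]
    have h := Finset.sum_pos (fun (w : Fin 9 → ZMod 2) (_ : w ∈ Finset.univ) =>
      derivative_polynomial_pos _ hR _ (htwist (fun x => s x * s (x + a)) hss fun x => w ⬝ᵥ x))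
      Finset.univ_nonempty
    simp only [elemSymm_zero, Finset.sum_add_distrib, ← Finset.mul_sum] at h
    rw [sum_elemSymm_pairs s hi (by decide), sum_elemSymm_pairs s hi (by decide),
      sum_elemSymm_pairs s hi (by decide),
      dualSumAt_eq_zero s (k := 2 * 2) fun S hS h => hS.card_ne_four_six (Or.inl h)] at h
    simp only [Finset.sum_const, hcard, nsmul_eq_mul] at h
    norm_num at h ⊢
    linarith
  have hcount : (Finset.univ.filter fun a : Fin 9 → ZMod 2 => a ≠ 0).card = 511 := by
    rw [Finset.filter_ne', Finset.card_erase_of_mem (Finset.mem_univ _), hcard]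
  have hsum := Finset.sum_pos hpos (by rw [← Finset.card_pos, hcount]; norm_num)
  rw [Finset.sum_add_distrib, Finset.sum_add_distrib, ← Finset.mul_sum, ← Finset.mul_sum,
    sum_dualSumAt s fun S hS h => hS.card_periods_of_card_eq_eight h,
    sum_dualSumAt s fun S hS h => hS.card_periods_of_card_eq_twelve h,
    Finset.sum_const, hcount, nsmul_eq_mul] at hsum
  push_cast at hsum
  linarith
end

section
/- Let f ∈ B_6. Then nl_2(f) = 16 if and only if f is affine equivalent modulo RM(2,6) to one of the five functions fun_1, fun_2, fun_3, fun_4, fun_5. -/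
open scoped BigOperators

namespace QuadraticNonlinearity

/-- The number of variables of the monomial encoded by the bits of `m`. -/
def deg (m : ℕ) : ℕ :=
  (m.testBit 0).toNat + (m.testBit 1).toNat + (m.testBit 2).toNat + (m.testBit 3).toNat +
    (m.testBit 4).toNat + (m.testBit 5).toNat

/-- Substituting `x_i + x_j` (or `x_i + 1` when `j = 6`) for `x_i` in a monomial `m` containing
`x_i` adds the monomial `swapVar i j m`. -/
def swapVar (i j m : ℕ) : ℕ := if j < 6 then (m ^^^ 2 ^ i) ||| 2 ^ j else m ^^^ 2 ^ i

/-- Adds the monomial `m` to a sum of monomials. -/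
def toggle (m : ℕ) (F : List ℕ) : List ℕ := if m ∈ F then F.erase m else m :: F

/-- The substitution `(i, j)` on a sum of monomials, up to terms of degree at most `r`. -/
def substSum (r i j : ℕ) (F : List ℕ) : List ℕ :=
  (F.filter (·.testBit i)).foldr
    (fun m G => if deg (swapVar i j m) ≤ r then G else toggle (swapVar i j m) G) F

/-- The set of `c < 2 ^ n` whose bit `k` is set, as a bit set. -/
def bitMask : ℕ → ℕ → ℕ
  | 0, _ => 0
  | n + 1, k =>
    if k = n then (2 ^ 2 ^ n - 1) <<< 2 ^ n else bitMask n k ||| (bitMask n k <<< 2 ^ n)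

/-- The set of all `c < 2 ^ n` as a bit set. -/
def fullMask (n : ℕ) : ℕ := 2 ^ 2 ^ n - 1

/-- Exchange the bits at distance `s` selected by the mask `M`. -/
def deltaSwap (M s S : ℕ) : ℕ :=
  S ^^^ ((S ^^^ (S >>> s)) &&& M) ^^^ (((S ^^^ (S >>> s)) &&& M) <<< s)

/-- Image of a bit set under flipping bit `l` of its elements whose bit `k` is set. -/
def cnotSet (n k l S : ℕ) : ℕ :=
  deltaSwap (bitMask n k &&& (fullMask n ^^^ bitMask n l)) (2 ^ l) S

/-- Image of a bit set under flipping bit `l` of its elements. -/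
def flipSet (n l S : ℕ) : ℕ := deltaSwap (fullMask n ^^^ bitMask n l) (2 ^ l) S

/-- The pairs `(k, l)` such that substitution `(i, j)` in the `k`-th monomial of `W` yields
the `l`-th one. -/
def substPairs (W : List ℕ) (i j : ℕ) : List (ℕ × ℕ) :=
  (List.range W.length).filterMap fun k =>
    if (W.getD k 0).testBit i ∧ swapVar i j (W.getD k 0) ∈ W then
      some (k, W.idxOf (swapVar i j (W.getD k 0))) else none

/-- Image of a bit set of sums of monomials in `W` under a list of controlled flips. -/
def cnotsSet (n : ℕ) (L : List (ℕ × ℕ)) (S : ℕ) : ℕ :=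
  L.foldl (fun S p => cnotSet n p.1 p.2 S) S

/-- Image of a coset `F + S` under a sequence of substitutions. -/
def substWord (W : List ℕ) (r : ℕ) : List (ℕ × ℕ) → List ℕ → ℕ → List ℕ × ℕ
  | [], F, S => (F, S)
  | (i, j) :: w, F, S =>
    substWord W r w (substSum r i j F) (cnotsSet W.length (substPairs W i j) S)

/-- Translate a bit set by the monomials in `D`; the result is empty if some of them are not
in `W`. -/
def translateSet (W D : List ℕ) (S : ℕ) : ℕ :=
  if ∀ m ∈ D, m ∈ W then D.foldl (fun S m => flipSet W.length (W.idxOf m) S) S else 0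

/-- Enlarge the bit set `S` by its image under a sequence of substitutions that fixes `F` up to
monomials in `W` and of degree at most `r`. -/
def enlarge (W : List ℕ) (r : ℕ) (F : List ℕ) (S : ℕ) (w : List (ℕ × ℕ)) : ℕ :=
  S ||| translateSet W (F.foldr toggle (substWord W r w F S).1) (substWord W r w F S).2

/-- The bit set with the given elements. -/
def bitSet (l : List ℕ) : ℕ := l.foldr (fun c S => (1 <<< c) ||| S) 0

/-- Starting with the representatives `reps`, the substitutions `ws` reach the whole coset. -/
def covers (W : List ℕ) (r : ℕ) (F reps : List ℕ) (ws : List (List (ℕ × ℕ))) : Bool :=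
  (ws.all fun w => w.all fun p => decide (p.1 < 6) && decide (p.2 < 7) && !decide (p.1 = p.2)) &&
    Nat.beq (ws.foldl (enlarge W r F) (bitSet reps)) (fullMask W.length)

def cubics : List ℕ := (List.range 64).filter (deg · = 3)
def highMonomials : List ℕ := (List.range 64).filter fun m => deg m = 4 ∨ deg m = 5
def lowMonomials : List ℕ := (List.range 64).filter (deg · ≤ 2)

/-- Truth table from algebraic normal form. -/
def truthTable (a : ℕ) : ℕ :=
  [(1, 6148914691236517205), (2, 3689348814741910323), (4, 1085102592571150095),
    (8, 71777214294589695), (16, 281470681808895), (32, 4294967295)].foldl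
    (fun a p => a ^^^ ((a &&& p.2) <<< p.1)) a

def countOnes (t : ℕ) : ℕ := Nat.count (fun n => t.testBit n = true) 64

def monSum (W : List ℕ) (c : ℕ) : ℕ :=
  (List.range W.length).foldr (fun k a => if c.testBit k then a ^^^ 2 ^ W.getD k 0 else a) 0

def listSum (F : List ℕ) : ℕ := F.foldr (fun m a => a ^^^ 2 ^ m) 0

/-- The set of `q` such that `t + q` takes the value 1 at the point encoded by `n`, where the bits
of `q` select a sum of monomials in `W`, as a bit set. -/
def valueSet (W : List ℕ) (t n : ℕ) : ℕ :=
  (List.range W.length).foldr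
    (fun k V => if W.getD k 0 &&& n = W.getD k 0 then V ^^^ bitMask W.length k else V)
    (if t.testBit n then fullMask W.length else 0)

/-- The set of `q` for which the points below the first numeric argument bring the counter of the
ones of `t + q` to 32: the bit sets `a`, ..., `e` hold the binary digits of the counters, and `s`
collects those that have overflowed. -/
def countSet (W : List ℕ) (t : ℕ) : ℕ → ℕ → ℕ → ℕ → ℕ → ℕ → ℕ → ℕ
  | 0, _, _, _, _, _, s => s
  | n + 1, a, b, c, d, e, s =>
    let v := valueSet W t n
    let v₁ := v &&& a
    let v₂ := v₁ &&& b
    let v₃ := v₂ &&& c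
    let v₄ := v₃ &&& d
    countSet W t n (a ^^^ v) (b ^^^ v₁) (c ^^^ v₂) (d ^^^ v₃) (e ^^^ v₄) (s ||| (v₄ &&& e))

lemma add_self_eq_zero {n : ℕ} (f : BF n) : f + f = 0 := by
  ext x; exact CharTwo.add_self_eq_zero (f x)

/-- `RM r n` as an additive subgroup. -/
def rm (r n : ℕ) : AddSubgroup (BF n) where
  carrier := RM r n
  zero_mem' := ⟨0, by simp, by simp⟩
  add_mem' := by
    rintro f g ⟨p, hp, hf⟩ ⟨q, hq, hg⟩
    exact ⟨p + q, (MvPolynomial.totalDegree_add p q).trans (max_le hp hq), by simp [hf, hg]⟩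
  neg_mem' := by
    rintro f ⟨p, hp, hf⟩
    exact ⟨-p, by simpa using hp, by simp [hf]⟩

lemma rm_mono {r s n : ℕ} (h : r ≤ s) : rm r n ≤ rm s n :=
  fun _ ⟨p, hp, hf⟩ => ⟨p, hp.trans h, hf⟩

lemma const_mem_rm {n : ℕ} (r : ℕ) (c : ZMod 2) : (fun _ => c : BF n) ∈ rm r n :=
  ⟨MvPolynomial.C c, by simp, by simp⟩

lemma coord_mem_rm {n : ℕ} (i : Fin n) : (fun x => x i : BF n) ∈ rm 1 n :=
  ⟨MvPolynomial.X i, by simp, by simp⟩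

lemma mul_mem_rm {r s n : ℕ} {f g : BF n} (hf : f ∈ rm r n) (hg : g ∈ rm s n) :
    f * g ∈ rm (r + s) n := by
  obtain ⟨p, hp, hf⟩ := hf
  obtain ⟨q, hq, hg⟩ := hg
  exact ⟨p * q, (MvPolynomial.totalDegree_mul p q).trans (add_le_add hp hq), by simp [hf, hg]⟩

lemma pow_mem_rm {n : ℕ} {f : BF n} (hf : f ∈ rm 1 n) (d : ℕ) : f ^ d ∈ rm d n := by
  induction d with
  | zero => rw [pow_zero]; exact const_mem_rm 0 1
  | succ d ih => rw [pow_succ]; exact mul_mem_rm ih hf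

lemma prod_mem_rm {n : ℕ} {ι : Type*} (s : Finset ι) (d : ι → ℕ) (f : ι → BF n)
    (h : ∀ i ∈ s, f i ∈ rm (d i) n) : ∏ i ∈ s, f i ∈ rm (∑ i ∈ s, d i) n := by
  classical
  induction s using Finset.induction_on with
  | empty => rw [Finset.prod_empty, Finset.sum_empty]; exact const_mem_rm 0 1
  | insert a s ha ih =>
    rw [Finset.prod_insert ha, Finset.sum_insert ha]
    exact mul_mem_rm (h a (by simp)) (ih fun i hi => h i (by simp [hi]))

lemma sum_le_totalDegree {n : ℕ} {p : MvPolynomial (Fin n) (ZMod 2)} {d : Fin n →₀ ℕ}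
    (hd : d ∈ p.support) : ∑ i, d i ≤ p.totalDegree := by
  have := MvPolynomial.le_totalDegree hd
  rwa [Finsupp.sum_fintype _ _ (by simp)] at this

lemma comp_mem_rm {r n : ℕ} {f : BF n} (hf : f ∈ rm r n)
    {T : (Fin n → ZMod 2) → Fin n → ZMod 2} (hT : ∀ i, (fun x => T x i) ∈ rm 1 n) :
    f ∘ T ∈ rm r n := by
  obtain ⟨p, hp, hf⟩ := hf
  have : f ∘ T = ∑ d ∈ p.support, (fun _ => p.coeff d) * ∏ i, (fun x => T x i) ^ d i := by
    ext x
    simp [hf, MvPolynomial.eval_eq', Finset.sum_apply, Finset.prod_apply]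
  rw [this]
  refine sum_mem fun d hd => rm_mono ?_
    (mul_mem_rm (const_mem_rm 0 _) (prod_mem_rm _ _ _ fun i _ => pow_mem_rm (hT i) (d i)))
  rw [zero_add]
  exact (sum_le_totalDegree hd).trans hp

/-- The monomial whose variables are given by the bits of `m`. -/
def mon (m : ℕ) : BF 6 := fun x => ∏ i : Fin 6, if m.testBit i then x i else 1

lemma deg_eq_sum (m : ℕ) : deg m = ∑ i : Fin 6, (m.testBit i).toNat := by
  simp [Fin.sum_univ_six, deg]

lemma mon_mem_rm {r m : ℕ} (h : deg m ≤ r) : mon m ∈ rm r 6 := by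
  have : mon m = ∏ i : Fin 6, fun x => if m.testBit i then x i else 1 := by
    ext x; simp [mon, Finset.prod_apply]
  rw [this]
  refine rm_mono (deg_eq_sum m ▸ h) (prod_mem_rm _ _ _ fun i _ => ?_)
  cases m.testBit i
  · simpa using const_mem_rm 0 1
  · simpa using coord_mem_rm i

lemma mem_closure_mon {s : ℕ} {f : BF 6} (hf : f ∈ rm s 6) :
    f ∈ AddSubgroup.closure {g | ∃ m < 64, deg m ≤ s ∧ g = mon m} := by
  obtain ⟨p, hp, hf⟩ := hf
  have : f = ∑ d ∈ p.support, fun x => p.coeff d * ∏ i, x i ^ d i := by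
    ext x
    simp [hf, MvPolynomial.eval_eq', Finset.sum_apply]
  rw [this]
  refine sum_mem fun d hd => AddSubgroup.subset_closure
    ⟨Nat.ofBits fun i : Fin 6 => decide (d i ≠ 0), Nat.ofBits_lt_two_pow _, ?_, ?_⟩
  · refine le_trans ?_ ((sum_le_totalDegree hd).trans hp)
    rw [deg_eq_sum]
    refine Finset.sum_le_sum fun i _ => ?_
    rw [Nat.testBit_ofBits_lt _ _ i.2]
    by_cases h : d i = 0 <;> simp [h]
    omega
  · have hc : p.coeff d = 1 := by
      have := MvPolynomial.mem_support_iff.1 hd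
      revert this
      generalize p.coeff d = c
      revert c; decide
    ext x
    simp only [hc, one_mul, mon]
    refine Finset.prod_congr rfl fun i _ => ?_
    rw [Nat.testBit_ofBits_lt _ _ i.2]
    by_cases h : d i = 0
    · simp [h]
    · have : ∀ (c : ZMod 2) (e : ℕ), e ≠ 0 → c ^ e = c := by
        intro c e he
        fin_cases c
        · exact zero_pow he
        · exact one_pow e
      simp [h, this]

lemma exists_mem_rm (f : BF 6) : ∃ s, f ∈ rm s 6 := by
  have h := MvPolynomial.map_restrict_dom_evalₗ (ZMod 2) (Fin 6)
  have hf : f ∈ (⊤ : Submodule (ZMod 2) (BF 6)) := trivial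
  rw [← h] at hf
  obtain ⟨p, -, hp⟩ := hf
  exact ⟨p.totalDegree, p, le_rfl, fun x => by rw [← hp]; rfl⟩

/-- The point whose coordinates are the bits of `n`. -/
def point (n : ℕ) : Fin 6 → ZMod 2 := fun i => if n.testBit i then 1 else 0

lemma mon_point (m n : ℕ) :
    mon m (point n) = if ∀ i : Fin 6, m.testBit i → n.testBit i then 1 else 0 := by
  have : mon m (point n) = ∏ i : Fin 6, if m.testBit i → n.testBit i then 1 else 0 := by
    refine Finset.prod_congr rfl fun i _ => ?_
    cases h : m.testBit i <;> simp [point]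
  rw [this, Finset.prod_ite_zero]
  simp

lemma exists_point (x : Fin 6 → ZMod 2) : ∃ n < 64, point n = x := by
  refine ⟨Nat.ofBits fun i : Fin 6 => decide (x i = 1), Nat.ofBits_lt_two_pow _, ?_⟩
  ext i
  have : ∀ c : ZMod 2, (if c = 1 then 1 else 0) = c := by decide
  simp [point, Nat.testBit_ofBits_lt _ _ i.2, this]

lemma point_injOn : Set.InjOn point {n | n < 64} := by
  intro a ha b hb h
  refine Nat.eq_of_testBit_eq fun i => ?_
  by_cases hi : i < 6
  · have := congrFun h ⟨i, hi⟩
    revert this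
    cases ha : a.testBit i <;> cases hb : b.testBit i <;> simp [point, ha, hb]
  · have h64 : 64 ≤ 2 ^ i := by
      calc 64 = 2 ^ 6 := by norm_num
        _ ≤ 2 ^ i := Nat.pow_le_pow_right (by norm_num) (by omega)
    rw [Nat.testBit_lt_two_pow (lt_of_lt_of_le ha h64),
      Nat.testBit_lt_two_pow (lt_of_lt_of_le hb h64)]

lemma hd_eq_count (f g : BF 6) : hd f g = Nat.count (fun n => f (point n) ≠ g (point n)) 64 := by
  rw [Nat.count_eq_card_filter_range, hd]
  symm
  refine Finset.card_bij (fun n _ => point n) ?_ ?_ ?_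
  · intro n hn; simpa using (Finset.mem_filter.1 hn).2
  · intro a ha b hb h
    exact point_injOn (Finset.mem_range.1 (Finset.mem_filter.1 ha).1)
      (Finset.mem_range.1 (Finset.mem_filter.1 hb).1) h
  · intro x hx
    obtain ⟨n, hn, rfl⟩ := exists_point x
    exact ⟨n, by simpa [hn] using hx, rfl⟩

/-- The sum of the monomials in `W` selected by the bits of `c`. -/
def linSum (W : List ℕ) (c : ℕ) : BF 6 :=
  ((List.range W.length).map fun k => if c.testBit k then mon (W.getD k 0) else 0).sum

lemma linSum_xor (W : List ℕ) (a b : ℕ) : linSum W (a ^^^ b) = linSum W a + linSum W b := by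
  rw [linSum, linSum, linSum, ← List.sum_map_add]
  congr 1
  refine List.map_congr_left fun k _ => ?_
  cases ha : a.testBit k <;> cases hb : b.testBit k <;>
    simp [ha, hb, add_self_eq_zero]

lemma linSum_zero (W : List ℕ) : linSum W 0 = 0 := by simp [linSum]

lemma list_sum_ite_eq {M : Type*} [AddCommMonoid M] (n k : ℕ) (h : k < n) (g : ℕ → M) :
    ((List.range n).map fun l => if k = l then g l else 0).sum = g k := by
  change ∑ l ∈ Finset.range n, (if k = l then g l else 0) = g k
  simp [h]

lemma linSum_two_pow (W : List ℕ) {k : ℕ} (h : k < W.length) :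
    linSum W (2 ^ k) = mon (W.getD k 0) := by
  simp only [linSum, Nat.testBit_two_pow, decide_eq_true_eq]
  exact list_sum_ite_eq _ _ h fun l => mon (W.getD l 0)

lemma exists_linSum (W : List ℕ) (s : ℕ) (A : AddSubgroup (BF 6))
    (h : ∀ m < 64, deg m ≤ s → m ∈ W ∨ mon m ∈ A) {f : BF 6} (hf : f ∈ rm s 6) :
    ∃ c < 2 ^ W.length, f + linSum W c ∈ A := by
  refine AddSubgroup.closure_induction (p := fun f _ => ∃ c < 2 ^ W.length, f + linSum W c ∈ A)
    ?_ ?_ ?_ ?_ (mem_closure_mon hf)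
  · rintro _ ⟨m, hm, hd, rfl⟩
    rcases h m hm hd with h | h
    · have hk := List.idxOf_lt_length_of_mem h
      refine ⟨2 ^ W.idxOf m, Nat.pow_lt_pow_right (by norm_num) hk, ?_⟩
      rw [linSum_two_pow _ hk, List.getD_eq_getElem _ _ hk, List.getElem_idxOf, add_self_eq_zero]
      exact zero_mem A
    · exact ⟨0, by positivity, by simpa [linSum_zero] using h⟩
  · exact ⟨0, by positivity, by simp [linSum_zero]⟩
  · rintro f g - - ⟨a, ha, hf⟩ ⟨b, hb, hg⟩
    refine ⟨a ^^^ b, Nat.xor_lt_two_pow ha hb, ?_⟩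
    rw [linSum_xor, add_add_add_comm]
    exact add_mem hf hg
  · rintro f - ⟨a, ha, hf⟩
    refine ⟨a, ha, ?_⟩
    rwa [neg_eq_of_add_eq_zero_right (add_self_eq_zero f)]

/-- The substitution of `x_i + x_j` (or `x_i + 1` when `j ≥ 6`) for `x_i`. -/
def subst (i j : ℕ) (x : Fin 6 → ZMod 2) : Fin 6 → ZMod 2 := fun k =>
  if k.val = i then x k + (if h : j < 6 then x ⟨j, h⟩ else 1) else x k

lemma subst_subst {i j : ℕ} (h : i ≠ j) (x : Fin 6 → ZMod 2) :
    subst i j (subst i j x) = x := by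
  ext k
  by_cases hk : k.val = i <;> by_cases hj : j < 6 <;>
    simp [subst, hk, hj, h.symm, add_assoc, CharTwo.add_self_eq_zero]

lemma subst_mem_rm (i j : ℕ) (k : Fin 6) : (fun x => subst i j x k) ∈ rm 1 6 := by
  unfold subst
  split_ifs with h hj
  · exact add_mem (coord_mem_rm k) (coord_mem_rm _)
  · exact add_mem (coord_mem_rm k) (const_mem_rm 1 1)
  · exact coord_mem_rm k

lemma mon_apply_eq_mul (m : ℕ) (i : Fin 6) (x : Fin 6 → ZMod 2) :
    mon m x = (if m.testBit i then x i else 1) *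
      ∏ k ∈ Finset.univ.erase i, if m.testBit k then x k else 1 :=
  (Finset.mul_prod_erase _ _ (Finset.mem_univ i)).symm

lemma mon_or_two_pow (m : ℕ) (j : Fin 6) (x : Fin 6 → ZMod 2) :
    mon (m ||| 2 ^ j.val) x = x j * mon m x := by
  rw [mon_apply_eq_mul _ j, mon_apply_eq_mul m j, ← mul_assoc]
  congr 1
  · have : ∀ c : ZMod 2, c = c * c := by decide
    cases h : m.testBit j <;> simp [h, ← this]
  · refine Finset.prod_congr rfl fun k hk => ?_
    have : j.val ≠ k.val := fun e => Finset.ne_of_mem_erase hk (Fin.ext e.symm)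
    simp [this]

lemma mon_xor_two_pow {m : ℕ} {i : Fin 6} (h : m.testBit i) (x : Fin 6 → ZMod 2) :
    mon (m ^^^ 2 ^ i.val) x = ∏ k ∈ Finset.univ.erase i, if m.testBit k then x k else 1 := by
  rw [mon_apply_eq_mul _ i]
  simp only [Nat.testBit_xor, h, Nat.testBit_two_pow_self, Bool.xor_self, Bool.false_eq_true,
    if_false, one_mul]
  refine Finset.prod_congr rfl fun k hk => ?_
  have : i.val ≠ k.val := fun e => Finset.ne_of_mem_erase hk (Fin.ext e.symm)
  simp [this]

lemma mon_comp_subst {i j : ℕ} (hi : i < 6) (m : ℕ) :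
    mon m ∘ subst i j = mon m + if m.testBit i then mon (swapVar i j m) else 0 := by
  ext x
  have h₁ : ∏ k ∈ Finset.univ.erase (⟨i, hi⟩ : Fin 6),
      (if m.testBit k then subst i j x k else 1) =
      ∏ k ∈ Finset.univ.erase (⟨i, hi⟩ : Fin 6), if m.testBit k then x k else 1 := by
    refine Finset.prod_congr rfl fun k hk => ?_
    have : k.val ≠ i := fun e => Finset.ne_of_mem_erase hk (Fin.ext e)
    simp [subst, this]
  have h₂ : subst i j x ⟨i, hi⟩ = x ⟨i, hi⟩ + if h : j < 6 then x ⟨j, h⟩ else 1 := by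
    simp [subst]
  rw [Function.comp_apply, mon_apply_eq_mul _ ⟨i, hi⟩, h₁, h₂, Pi.add_apply,
    mon_apply_eq_mul m ⟨i, hi⟩]
  cases h : m.testBit i
  · simp
  · have h₃ : m.testBit (⟨i, hi⟩ : Fin 6) := h
    by_cases hj : j < 6
    · have := mon_or_two_pow (m ^^^ 2 ^ i) ⟨j, hj⟩ x
      have h₄ := mon_xor_two_pow h₃ x
      simp only at this h₄
      simp only [swapVar, hj, if_true, dif_pos, this, h₄]
      ring
    · have h₄ := mon_xor_two_pow h₃ x
      simp only at h₄
      simp only [swapVar, hj, if_true, if_false, dif_neg, not_false_eq_true, h₄]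
      ring

/-- The sum of the monomials in a list. -/
def sumMon (F : List ℕ) : BF 6 := (F.map mon).sum

lemma sumMon_toggle (m : ℕ) (F : List ℕ) : sumMon (toggle m F) = mon m + sumMon F := by
  unfold toggle
  split_ifs with h
  · rw [sumMon, sumMon, ← List.sum_map_erase mon h, ← add_assoc, add_self_eq_zero, zero_add]
  · simp [sumMon]

lemma sumMon_foldr_toggle (F G : List ℕ) :
    sumMon (F.foldr toggle G) = sumMon F + sumMon G := by
  induction F with
  | nil => simp [sumMon]
  | cons m F ih => rw [List.foldr_cons, sumMon_toggle, ih]; simp [sumMon, add_assoc]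

lemma add_mem_of_add_mem {A : AddSubgroup (BF 6)} {f g h : BF 6} (hfg : f + g ∈ A)
    (hgh : g + h ∈ A) : f + h ∈ A := by
  have := add_mem hfg hgh
  rwa [add_assoc, ← add_assoc g, add_self_eq_zero, zero_add] at this

lemma sum_comp {α : Type*} (L : List α) (g : α → BF 6)
    (T : (Fin 6 → ZMod 2) → Fin 6 → ZMod 2) :
    (L.map g).sum ∘ T = (L.map fun a => g a ∘ T).sum := by
  induction L with
  | nil => rfl
  | cons a L ih => simp only [List.map_cons, List.sum_cons, ← ih]; rfl

lemma sumMon_comp_subst {i j : ℕ} (hi : i < 6) (F : List ℕ) :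
    sumMon F ∘ subst i j =
      sumMon F + ((F.filter (·.testBit i)).map fun m => mon (swapVar i j m)).sum := by
  rw [sumMon, sum_comp]
  induction F with
  | nil => simp
  | cons m F ih =>
    simp only [List.map_cons, List.sum_cons, List.filter_cons]
    rw [ih, mon_comp_subst hi]
    cases m.testBit i
    · simp [add_assoc]
    · simp only [if_true, List.map_cons, List.sum_cons]
      abel

lemma substSum_add_mem {i j : ℕ} (hi : i < 6) (r : ℕ) (F : List ℕ) :
    sumMon (substSum r i j F) + sumMon F ∘ subst i j ∈ rm r 6 := by
  rw [sumMon_comp_subst hi, substSum]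
  generalize F.filter (·.testBit i) = G
  induction G with
  | nil => simp [add_self_eq_zero]
  | cons m G ih =>
    simp only [List.foldr_cons, List.map_cons, List.sum_cons]
    split_ifs with h
    · convert add_mem (mon_mem_rm h) ih using 1
      abel
    · rw [sumMon_toggle]
      convert ih using 1
      rw [add_comm (mon _) (sumMon _), add_left_comm (sumMon F), add_assoc, ← add_assoc (mon _),
        add_self_eq_zero, zero_add]

/-- Flip bit `p.2` of `c` if bit `p.1` is set. -/
def cnot (p : ℕ × ℕ) (c : ℕ) : ℕ := if c.testBit p.1 then c ^^^ 2 ^ p.2 else c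

lemma testBit_foldr_cnot {k : ℕ} {L : List (ℕ × ℕ)} (h : ∀ q ∈ L, q.2 ≠ k) (c : ℕ) :
    (L.foldr cnot c).testBit k = c.testBit k := by
  induction L with
  | nil => rfl
  | cons p L ih =>
    rw [List.forall_mem_cons] at h
    rw [List.foldr_cons, ← ih h.2, cnot]
    split_ifs
    · simp [h.1]
    · rfl

lemma foldr_cnot_lt {n : ℕ} {L : List (ℕ × ℕ)} (h : ∀ q ∈ L, q.2 < n) {c : ℕ}
    (hc : c < 2 ^ n) : L.foldr cnot c < 2 ^ n := by
  induction L with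
  | nil => exact hc
  | cons p L ih =>
    rw [List.forall_mem_cons] at h
    rw [List.foldr_cons, cnot]
    split_ifs
    · exact Nat.xor_lt_two_pow (ih h.2) (Nat.pow_lt_pow_right (by norm_num) h.1)
    · exact ih h.2

lemma linSum_foldr_cnot (W : List ℕ) {L : List (ℕ × ℕ)} (h : ∀ p ∈ L, ∀ q ∈ L, q.2 ≠ p.1)
    (hL : ∀ q ∈ L, q.2 < W.length) (c : ℕ) :
    linSum W (L.foldr cnot c) =
      linSum W c + (L.map fun p => if c.testBit p.1 then mon (W.getD p.2 0) else 0).sum := by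
  induction L with
  | nil => simp
  | cons p L ih =>
    have hp : (L.foldr cnot c).testBit p.1 = c.testBit p.1 :=
      testBit_foldr_cnot (fun q hq => h p (by simp) q (by simp [hq])) c
    have ih' := ih (fun p hp q hq => h p (by simp [hp]) q (by simp [hq]))
      (fun q hq => hL q (by simp [hq]))
    rw [List.foldr_cons, cnot, hp, List.map_cons, List.sum_cons]
    split_ifs
    · rw [linSum_xor, ih', linSum_two_pow _ (hL p (by simp))]
      abel
    · rw [ih', zero_add]

/-- Substitutions map monomials in `W` to sums of monomials that are in `W` or of degree at most
`r`. -/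
def Closed (W : List ℕ) (r : ℕ) : Prop :=
  ∀ i < 6, ∀ j < 7, i ≠ j → ∀ m ∈ W, m.testBit i →
    swapVar i j m ∈ W ∨ deg (swapVar i j m) ≤ r

instance (W : List ℕ) (r : ℕ) : Decidable (Closed W r) := by unfold Closed; infer_instance

lemma mem_substPairs {W : List ℕ} {i j : ℕ} {p : ℕ × ℕ} (hp : p ∈ substPairs W i j) :
    p.1 < W.length ∧ p.2 < W.length ∧ (W.getD p.1 0).testBit i ∧
      W.getD p.2 0 = swapVar i j (W.getD p.1 0) := by
  simp only [substPairs, List.mem_filterMap, List.mem_range, Option.ite_none_right_eq_some,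
    Option.some.injEq] at hp
  obtain ⟨k, hk, ⟨h₁, h₂⟩, rfl⟩ := hp
  have := List.idxOf_lt_length_of_mem h₂
  refine ⟨hk, this, h₁, ?_⟩
  rw [List.getD_eq_getElem _ _ this, List.getElem_idxOf]

lemma testBit_swapVar {i j m : ℕ} (h : i ≠ j) (hm : m.testBit i) :
    (swapVar i j m).testBit i = false := by
  unfold swapVar
  split_ifs <;> simp [hm, h.symm]

lemma substPairs_disjoint {W : List ℕ} {i j : ℕ} (h : i ≠ j) {p q : ℕ × ℕ}
    (hp : p ∈ substPairs W i j) (hq : q ∈ substPairs W i j) : q.2 ≠ p.1 := by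
  intro e
  have h₁ := (mem_substPairs hp).2.2.1
  obtain ⟨-, -, h₂, h₃⟩ := mem_substPairs hq
  rw [← e, h₃, testBit_swapVar h h₂] at h₁
  exact Bool.false_ne_true h₁

lemma sum_map_filterMap {α β M : Type*} [AddCommMonoid M] (L : List α) (φ : α → Option β)
    (ψ : β → M) :
    ((L.filterMap φ).map ψ).sum = (L.map fun a => ((φ a).map ψ).getD 0).sum := by
  induction L with
  | nil => simp
  | cons a L ih =>
    rw [List.filterMap_cons, List.map_cons, List.sum_cons, ← ih]
    cases φ a <;> simp

lemma linSum_substPairs_add_mem {W : List ℕ} {r i j : ℕ} (hW : Closed W r) (hi : i < 6)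
    (hj : j < 7) (h : i ≠ j) (c : ℕ) :
    linSum W ((substPairs W i j).foldr cnot c) + linSum W c ∘ subst i j ∈ rm r 6 := by
  rw [linSum_foldr_cnot W (fun p hp q hq => substPairs_disjoint h hp hq)
    (fun q hq => (mem_substPairs hq).2.1), linSum, sum_comp, substPairs]
  rw [sum_map_filterMap, ← List.sum_map_add, ← List.sum_map_add]
  refine list_sum_mem fun g hg => ?_
  obtain ⟨k, hk, rfl⟩ := List.mem_map.1 hg
  rw [List.mem_range] at hk
  have hm : W.getD k 0 ∈ W := by
    rw [List.getD_eq_getElem _ _ hk]; exact List.getElem_mem _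
  cases hc : c.testBit k
  · have : (0 : BF 6) ∘ subst i j = 0 := rfl
    simp only [Bool.false_eq_true, if_false, this]
    split_ifs <;> simp [hc]
  · simp only [if_true, mon_comp_subst hi]
    by_cases hb : (W.getD k 0).testBit i
    · by_cases hs : swapVar i j (W.getD k 0) ∈ W
      · have := List.idxOf_lt_length_of_mem hs
        have hs' : W.getD (W.idxOf (swapVar i j (W.getD k 0))) 0 = swapVar i j (W.getD k 0) := by
          rw [List.getD_eq_getElem _ _ this, List.getElem_idxOf]
        rw [if_pos ⟨hb, hs⟩, if_pos hb]
        simp only [Option.map_some, Option.getD_some, hc, if_true, hs', add_self_eq_zero]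
        exact zero_mem _
      · rw [if_neg (fun h => hs h.2), if_pos hb]
        simp only [Option.map_none, Option.getD_none, add_zero]
        rw [← add_assoc, add_self_eq_zero, zero_add]
        exact mon_mem_rm ((hW i hi j hj h _ hm hb).resolve_left hs)
    · rw [if_neg (fun h => hb h.1), if_neg hb]
      simp [add_self_eq_zero]

lemma add_two_pow_eq_xor {c l : ℕ} (h : c.testBit l = false) : c + 2 ^ l = c ^^^ 2 ^ l := by
  have hb : c % 2 ^ l < 2 ^ l := Nat.mod_lt _ (by positivity)
  have hq : c / 2 ^ l % 2 = 0 := by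
    rw [Nat.testBit_eq_decide_div_mod_eq] at h
    have := of_decide_eq_false h
    omega
  have hc := Nat.div_add_mod c (2 ^ l)
  have hc' : c + 2 ^ l = 2 ^ l * (c / 2 ^ l + 1) + c % 2 ^ l := by
    rw [mul_add, mul_one, add_right_comm, hc]
  refine Nat.eq_of_testBit_eq fun j => ?_
  rw [hc', Nat.testBit_xor]
  conv_rhs => rw [← hc]
  rw [Nat.testBit_two_pow_mul_add _ hb, Nat.testBit_two_pow_mul_add _ hb]
  by_cases hj : j < l
  · rw [if_pos hj, if_pos hj, Nat.testBit_two_pow_of_ne (by omega), Bool.xor_false]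
  · obtain ⟨e, rfl⟩ := Nat.exists_eq_add_of_le (not_lt.1 hj)
    rw [if_neg hj, if_neg hj, Nat.add_sub_cancel_left]
    cases e with
    | zero => simp [Nat.testBit_zero, hq, Nat.add_mod]
    | succ e =>
      rw [Nat.testBit_two_pow_of_ne (by omega), Nat.testBit_succ, Nat.testBit_succ]
      simp [(by omega : (c / 2 ^ l + 1) / 2 = c / 2 ^ l / 2)]

lemma testBit_deltaSwap {M n l S : ℕ} {p : ℕ → Bool} (hl : l < n)
    (hM : ∀ c, M.testBit c = (decide (c < 2 ^ n) && (p c && !c.testBit l)))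
    (hp : ∀ c, p (c ^^^ 2 ^ l) = p c) {c : ℕ} (hc : c < 2 ^ n) :
    (deltaSwap M (2 ^ l) S).testBit c = S.testBit (if p c then c ^^^ 2 ^ l else c) := by
  have hx : c ^^^ 2 ^ l < 2 ^ n := Nat.xor_lt_two_pow hc (Nat.pow_lt_pow_right (by norm_num) hl)
  unfold deltaSwap
  simp only [Nat.testBit_xor, Nat.testBit_and, Nat.testBit_shiftLeft, Nat.testBit_shiftRight, hM]
  cases h : c.testBit l
  · have h₁ : (decide (c ≥ 2 ^ l) && !(c - 2 ^ l).testBit l) = false := by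
      by_cases hcl : 2 ^ l ≤ c
      · have := Nat.testBit_two_pow_add_eq (c - 2 ^ l) l
        rw [Nat.add_sub_cancel' hcl, h] at this
        simpa [hcl] using this
      · simp [hcl]
    rw [add_comm (2 ^ l) c, add_two_pow_eq_xor h]
    generalize (c - 2 ^ l).testBit l = b at h₁ ⊢
    cases hcl : decide (c ≥ 2 ^ l) <;> cases b <;> cases hpc : p c <;> simp_all
  · have hs : c - 2 ^ l = c ^^^ 2 ^ l := by
      have h₂ := add_two_pow_eq_xor (c := c ^^^ 2 ^ l) (l := l) (by simp [h])
      rw [Nat.xor_assoc, Nat.xor_self, Nat.xor_zero] at h₂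
      omega
    have hle : 2 ^ l ≤ c := Nat.ge_two_pow_of_testBit h
    rw [Nat.add_sub_cancel' hle, hs]
    cases hpc : p c
    · simp [h, hpc, hp]
    · simp only [hpc, hp, hx, hle]
      cases S.testBit c <;> simp [h]

lemma testBit_fullMask (n c : ℕ) : (fullMask n).testBit c = decide (c < 2 ^ n) := by
  simp [fullMask]

lemma testBit_sub_two_pow {c n k : ℕ} (hk : k < n) (hc : 2 ^ n ≤ c) :
    (c - 2 ^ n).testBit k = c.testBit k := by
  have := Nat.testBit_two_pow_add_gt hk (c - 2 ^ n)
  rwa [Nat.add_sub_cancel' hc, eq_comm] at this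

lemma testBit_bitMask {n k : ℕ} (hk : k < n) (c : ℕ) :
    (bitMask n k).testBit c = (decide (c < 2 ^ n) && c.testBit k) := by
  induction n generalizing c with
  | zero => omega
  | succ n ih =>
    have h2 : 2 ^ (n + 1) = 2 ^ n + 2 ^ n := by rw [pow_succ]; omega
    rw [bitMask]
    split_ifs with h
    · subst h
      rw [Nat.testBit_shiftLeft, Nat.testBit_two_pow_sub_one]
      by_cases h₁ : 2 ^ k ≤ c
      · by_cases h₃ : c < 2 ^ (k + 1)
        · have h₄ : c.testBit k = true := by
            have := Nat.testBit_two_pow_add_eq (c - 2 ^ k) k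
            rwa [Nat.add_sub_cancel' h₁, Nat.testBit_lt_two_pow (by omega : c - 2 ^ k < 2 ^ k)] at this
          simp [h₁, h₃, h₄]
          omega
        · simp [h₁, h₃]
          omega
      · simp [h₁, Nat.testBit_lt_two_pow (not_le.1 h₁)]
    · have hk' : k < n := by omega
      rw [Nat.testBit_or, Nat.testBit_shiftLeft, ih hk', ih hk']
      by_cases h₁ : 2 ^ n ≤ c
      · rw [testBit_sub_two_pow hk' h₁]
        simp only [ge_iff_le, h₁, not_lt.2 h₁, decide_true, decide_false, Bool.false_and,
          Bool.true_and, Bool.false_or]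
        congr 2
        simp only [eq_iff_iff]
        omega
      · simp [h₁, not_le.1 h₁, (by omega : c < 2 ^ (n + 1))]

lemma testBit_cnotSet {n : ℕ} {p : ℕ × ℕ} (h₁ : p.1 < n) (h₂ : p.2 < n) (h : p.2 ≠ p.1) (S : ℕ)
    {c : ℕ} (hc : c < 2 ^ n) : (cnotSet n p.1 p.2 S).testBit c = S.testBit (cnot p c) := by
  rw [cnotSet, testBit_deltaSwap (p := fun c => c.testBit p.1) h₂ _ _ hc, cnot]
  · intro c
    rw [Nat.testBit_and, Nat.testBit_xor, testBit_bitMask h₁, testBit_bitMask h₂,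
      testBit_fullMask]
    cases decide (c < 2 ^ n) <;> simp
  · intro c; simp [h]

lemma testBit_flipSet {n l : ℕ} (hl : l < n) (S : ℕ) {c : ℕ} (hc : c < 2 ^ n) :
    (flipSet n l S).testBit c = S.testBit (c ^^^ 2 ^ l) := by
  rw [flipSet, testBit_deltaSwap (p := fun _ => true) hl _ _ hc]
  · rfl
  · intro c
    rw [Nat.testBit_xor, testBit_bitMask hl, testBit_fullMask]
    cases decide (c < 2 ^ n) <;> simp
  · intro c; rfl

lemma testBit_cnotsSet {n : ℕ} {L : List (ℕ × ℕ)}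
    (h : ∀ p ∈ L, p.1 < n ∧ p.2 < n ∧ p.2 ≠ p.1) (S : ℕ) {c : ℕ} (hc : c < 2 ^ n) :
    (cnotsSet n L S).testBit c = S.testBit (L.foldr cnot c) := by
  induction L generalizing S with
  | nil => rfl
  | cons p L ih =>
    rw [List.forall_mem_cons] at h
    rw [List.foldr_cons, ← testBit_cnotSet h.1.1 h.1.2.1 h.1.2.2 S
      (foldr_cnot_lt (fun q hq => (h.2 q hq).2.1) hc), ← ih h.2]
    rfl

lemma testBit_bitSet (l : List ℕ) (c : ℕ) : (bitSet l).testBit c = true ↔ c ∈ l := by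
  induction l with
  | nil => simp [bitSet]
  | cons a l ih =>
    rw [bitSet, List.foldr_cons, ← bitSet, Nat.testBit_or, Bool.or_eq_true, ih, List.mem_cons,
      Nat.one_shiftLeft, Nat.testBit_two_pow]
    simp [eq_comm]

/-- The property `P` of Boolean functions is invariant modulo `RM r 6` and under substitutions. -/
structure Invariant (r : ℕ) (P : BF 6 → Prop) : Prop where
  of_add_mem : ∀ f g, f + g ∈ rm r 6 → P f → P g
  comp_subst : ∀ i j f, i < 6 → i ≠ j → P f → P (f ∘ subst i j)

/-- All elements of the coset `φ + S` have the property `P`. -/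
def AllHave (P : BF 6 → Prop) (W : List ℕ) (φ : BF 6) (S : ℕ) : Prop :=
  ∀ c < 2 ^ W.length, S.testBit c = true → P (φ + linSum W c)

lemma AllHave.cnotsSet {r : ℕ} {P : BF 6 → Prop} (hP : Invariant r P) {W : List ℕ}
    (hW : Closed W r) {i j : ℕ} (hi : i < 6) (hj : j < 7) (h : i ≠ j) {F : List ℕ} {S : ℕ}
    (hS : AllHave P W (sumMon F) S) :
    AllHave P W (sumMon (substSum r i j F)) (cnotsSet W.length (substPairs W i j) S) := by
  intro c hc hb
  rw [testBit_cnotsSet (fun p hp => ⟨(mem_substPairs hp).1, (mem_substPairs hp).2.1,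
    substPairs_disjoint h hp hp⟩) S hc] at hb
  refine hP.of_add_mem _ _ ?_ (hP.comp_subst i j _ hi h
    (hS _ (foldr_cnot_lt (fun q hq => (mem_substPairs hq).2.1) hc) hb))
  have h₁ := substSum_add_mem (j := j) hi r F
  have h₂ := comp_mem_rm (linSum_substPairs_add_mem hW hi hj h c) (subst_mem_rm i j)
  convert add_mem h₁ h₂ using 1
  ext x
  simp only [Pi.add_apply, Function.comp_apply, subst_subst h]
  ring

lemma AllHave.substWord {r : ℕ} {P : BF 6 → Prop} (hP : Invariant r P) {W : List ℕ}
    (hW : Closed W r) {w : List (ℕ × ℕ)} (hw : ∀ p ∈ w, p.1 < 6 ∧ p.2 < 7 ∧ p.1 ≠ p.2)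
    {F : List ℕ} {S : ℕ} (hS : AllHave P W (sumMon F) S) :
    AllHave P W (sumMon (substWord W r w F S).1) (substWord W r w F S).2 := by
  induction w generalizing F S with
  | nil => exact hS
  | cons p w ih =>
    rw [List.forall_mem_cons] at hw
    exact ih hw.2 (hS.cnotsSet hP hW hw.1.1 hw.1.2.1 hw.1.2.2)

lemma AllHave.flipSets {P : BF 6 → Prop} {W D : List ℕ} (hD : ∀ m ∈ D, m ∈ W)
    {φ : BF 6} {S : ℕ} (hS : AllHave P W φ S) :
    AllHave P W (φ + sumMon D) (D.foldl (fun S m => flipSet W.length (W.idxOf m) S) S) := by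
  induction D generalizing φ S with
  | nil => simpa [sumMon] using hS
  | cons m D ih =>
    rw [List.forall_mem_cons] at hD
    have hl := List.idxOf_lt_length_of_mem hD.1
    have := ih hD.2 (φ := φ + mon m) (S := flipSet W.length (W.idxOf m) S) ?_
    · simpa [sumMon, add_assoc] using this
    · intro c hc hb
      rw [testBit_flipSet hl S hc] at hb
      have := hS _ (Nat.xor_lt_two_pow hc (Nat.pow_lt_pow_right (by norm_num) hl)) hb
      rw [linSum_xor, linSum_two_pow _ hl, List.getD_eq_getElem _ _ hl, List.getElem_idxOf] at this
      rwa [add_assoc, add_comm (mon m)]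

lemma AllHave.enlarge {r : ℕ} {P : BF 6 → Prop} (hP : Invariant r P) {W : List ℕ}
    (hW : Closed W r) {w : List (ℕ × ℕ)} (hw : ∀ p ∈ w, p.1 < 6 ∧ p.2 < 7 ∧ p.1 ≠ p.2)
    {F : List ℕ} {S : ℕ} (hS : AllHave P W (sumMon F) S) :
    AllHave P W (sumMon F) (enlarge W r F S w) := by
  intro c hc hb
  rw [QuadraticNonlinearity.enlarge, Nat.testBit_or, Bool.or_eq_true] at hb
  rcases hb with hb | hb
  · exact hS c hc hb
  · rw [translateSet] at hb
    split_ifs at hb with hD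
    · have := (hS.substWord hP hW hw).flipSets hD c hc hb
      rwa [sumMon_foldr_toggle, add_left_comm, add_self_eq_zero, add_zero] at this
    · simp at hb

lemma forall_of_covers {r : ℕ} {P : BF 6 → Prop} (hP : Invariant r P) {W : List ℕ}
    (hW : Closed W r) {F reps : List ℕ} {ws : List (List (ℕ × ℕ))}
    (h : covers W r F reps ws = true) (hreps : ∀ c ∈ reps, P (sumMon F + linSum W c)) :
    ∀ c < 2 ^ W.length, P (sumMon F + linSum W c) := by
  rw [covers, Bool.and_eq_true, List.all_eq_true] at h
  obtain ⟨hw, hfull⟩ := h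
  replace hfull := Nat.eq_of_beq_eq_true hfull
  have key : ∀ S, AllHave P W (sumMon F) S →
      AllHave P W (sumMon F) (ws.foldl (QuadraticNonlinearity.enlarge W r F) S) := by
    clear hfull
    induction ws with
    | nil => exact fun S hS => hS
    | cons w ws ih =>
      rw [List.forall_mem_cons] at hw
      refine fun S hS => ih hw.2 _ (hS.enlarge hP hW (w := w) ?_)
      simpa [and_assoc] using hw.1
  have := key (bitSet reps) fun c _ hb => hreps c ((testBit_bitSet _ _).1 hb)
  rw [hfull] at this
  exact fun c hc => this c hc (by simpa [testBit_fullMask] using hc)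

lemma nl_le {r n : ℕ} (f : BF n) {g : BF n} (hg : g ∈ rm r n) : nl r f ≤ hd f g :=
  Nat.sInf_le ⟨g, hg, rfl⟩

lemma exists_hd_eq_nl {n : ℕ} (r : ℕ) (f : BF n) : ∃ g ∈ rm r n, nl r f = hd f g :=
  Nat.sInf_mem (s := {d | ∃ g ∈ RM r n, d = hd f g}) ⟨_, 0, (rm r n).zero_mem, rfl⟩

lemma nl_le_nl_of_add_mem {r : ℕ} {f g : BF 6} (h : f + g ∈ rm r 6) : nl r g ≤ nl r f := by
  obtain ⟨q, hq, e⟩ := exists_hd_eq_nl r f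
  rw [e]
  refine (nl_le g (add_mem h hq)).trans (le_of_eq ?_)
  unfold hd
  congr 1
  refine Finset.filter_congr fun x _ => ?_
  have : ∀ a b c : ZMod 2, b ≠ a + b + c ↔ a ≠ c := by decide
  exact this _ _ _

lemma nl_eq_nl_of_add_mem {r : ℕ} {f g : BF 6} (h : f + g ∈ rm r 6) : nl r f = nl r g :=
  le_antisymm (nl_le_nl_of_add_mem (add_comm f g ▸ h)) (nl_le_nl_of_add_mem h)

lemma nl_comp_le {r n : ℕ} (f : BF n) {T : (Fin n → ZMod 2) → Fin n → ZMod 2}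
    (hT : ∀ i, (fun x => T x i) ∈ rm 1 n) (hT' : T.Injective) : nl r (f ∘ T) ≤ nl r f := by
  obtain ⟨q, hq, e⟩ := exists_hd_eq_nl r f
  rw [e]
  refine (nl_le (f ∘ T) (comp_mem_rm hq hT)).trans ?_
  exact Finset.card_le_card_of_injOn T (fun x hx => by simpa using hx) hT'.injOn

lemma mulVec_add_mem_rm {n : ℕ} (A : Matrix (Fin n) (Fin n) (ZMod 2)) (b : Fin n → ZMod 2)
    (i : Fin n) : (fun x => (A.mulVec x + b) i) ∈ rm 1 n := by
  have : (fun x => (A.mulVec x + b) i : BF n) =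
      (∑ j, (fun _ => A i j) * fun x => x j) + fun _ => b i := by
    ext x
    simp [Matrix.mulVec, dotProduct]
  rw [this]
  refine add_mem (sum_mem fun j _ => ?_) (const_mem_rm 1 _)
  exact mul_mem_rm (r := 0) (const_mem_rm 0 _) (coord_mem_rm j)

lemma nl_comp_mulVec_add {r n : ℕ} (f : BF n) {A : Matrix (Fin n) (Fin n) (ZMod 2)}
    (hA : IsUnit A) (b : Fin n → ZMod 2) : nl r (fun x => f (A.mulVec x + b)) = nl r f := by
  obtain ⟨A, rfl⟩ := hA
  set B : Matrix (Fin n) (Fin n) (ZMod 2) := ↑A⁻¹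
  have hAB : (A : Matrix (Fin n) (Fin n) (ZMod 2)) * B = 1 := A.mul_inv
  have hBA : B * (A : Matrix (Fin n) (Fin n) (ZMod 2)) = 1 := A.inv_mul
  have hv : ∀ v : Fin n → ZMod 2, v + v = 0 := fun v => funext fun i =>
    CharTwo.add_self_eq_zero (v i)
  have h₁ : Function.LeftInverse (fun x => B.mulVec x + B.mulVec b)
      fun x => (A : Matrix (Fin n) (Fin n) (ZMod 2)).mulVec x + b := by
    intro x
    simp only [Matrix.mulVec_add, Matrix.mulVec_mulVec, hBA, Matrix.one_mulVec, add_assoc, hv,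
      add_zero]
  have h₂ : Function.RightInverse (fun x => B.mulVec x + B.mulVec b)
      fun x => (A : Matrix (Fin n) (Fin n) (ZMod 2)).mulVec x + b := by
    intro x
    simp only [Matrix.mulVec_add, Matrix.mulVec_mulVec, hAB, Matrix.one_mulVec, add_assoc, hv,
      add_zero]
  refine le_antisymm (nl_comp_le f (mulVec_add_mem_rm _ b) h₁.injective) ?_
  have := nl_comp_le (r := r) (fun x => f ((A : Matrix (Fin n) (Fin n) (ZMod 2)).mulVec x + b))
    (mulVec_add_mem_rm B (B.mulVec b)) h₂.injective
  refine le_of_eq_of_le ?_ this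
  congr 1
  ext x
  exact congrArg f (h₂ x).symm

lemma exists_subst_eq {i j : ℕ} (hi : i < 6) (h : i ≠ j) :
    ∃ B : Matrix (Fin 6) (Fin 6) (ZMod 2), IsUnit B ∧ ∃ b, ∀ x, subst i j x = B.mulVec x + b := by
  by_cases hj : j < 6
  · refine ⟨Matrix.transvection ⟨i, hi⟩ ⟨j, hj⟩ 1, ?_, 0, fun x => ?_⟩
    · rw [Matrix.isUnit_iff_isUnit_det, Matrix.det_transvection_of_ne _ _ (by simpa using h)]
      exact isUnit_one
    · ext k
      simp only [Matrix.transvection, Matrix.add_mulVec, Matrix.one_mulVec, subst, hj,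
        Pi.add_apply, Matrix.single_mulVec]
      by_cases hk : k.val = i
      · obtain rfl : k = ⟨i, hi⟩ := Fin.ext hk
        simp
      · have : k ≠ ⟨i, hi⟩ := fun e => hk (congrArg Fin.val e)
        simp [hk, this]
  · refine ⟨1, isUnit_one, Pi.single ⟨i, hi⟩ 1, fun x => ?_⟩
    ext k
    by_cases hk : k.val = i
    · obtain rfl : k = ⟨i, hi⟩ := Fin.ext hk
      simp [subst, hj]
    · have : k ≠ ⟨i, hi⟩ := fun e => hk (congrArg Fin.val e)
      simp [subst, hk, this]

lemma affEquivMod_of_add_mem {r : ℕ} {f g h : BF 6} (hfg : f + g ∈ rm r 6)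
    (H : AffEquivMod r 6 f h) : AffEquivMod r 6 g h := by
  obtain ⟨A, hA, b, H⟩ := H
  exact ⟨A, hA, b, add_mem_of_add_mem (f := g) (g := f) (h := fun x => h (A.mulVec x + b))
    (add_comm f g ▸ hfg) H⟩

lemma affEquivMod_comp_subst {r i j : ℕ} (hi : i < 6) (hij : i ≠ j) {f h : BF 6}
    (H : AffEquivMod r 6 f h) : AffEquivMod r 6 (f ∘ subst i j) h := by
  obtain ⟨A, hA, b, H⟩ := H
  obtain ⟨B, hB, b', hT⟩ := exists_subst_eq hi hij
  refine ⟨A * B, hA.mul hB, A.mulVec b' + b, ?_⟩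
  have e : (fun x => (f ∘ subst i j) x + h ((A * B).mulVec x + (A.mulVec b' + b))) =
      (fun x => f x + h (A.mulVec x + b)) ∘ subst i j := by
    ext x
    simp only [Function.comp_apply, hT, Matrix.mulVec_add, Matrix.mulVec_mulVec, add_assoc]
  rw [e]
  exact comp_mem_rm H (subst_mem_rm i j)

lemma affEquivMod_refl (r n : ℕ) (f : BF n) : AffEquivMod r n f f := by
  refine ⟨1, isUnit_one, 0, ?_⟩
  have e : (fun x => f x + f (Matrix.mulVec 1 x + 0)) = 0 := by
    ext x
    simp [CharTwo.add_self_eq_zero]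
  rw [e]
  exact (rm r n).zero_mem

lemma _root_.AffEquivMod.nl_eq {r : ℕ} {f h : BF 6} (H : AffEquivMod r 6 f h) : nl r f = nl r h := by
  obtain ⟨A, hA, b, H⟩ := H
  exact (nl_eq_nl_of_add_mem H).trans (nl_comp_mulVec_add h hA b)

/-- `f` is affine equivalent modulo `RM 2 6` to one of `fun1`, ..., `fun5`. -/
def IsStandard (f : BF 6) : Prop :=
  AffEquivMod 2 6 f fun1 ∨ AffEquivMod 2 6 f fun2 ∨ AffEquivMod 2 6 f fun3 ∨
    AffEquivMod 2 6 f fun4 ∨ AffEquivMod 2 6 f fun5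

/-- The nontrivial direction of the characterization of `nl 2 f = 16`. -/
def StandardOfNl (f : BF 6) : Prop := nl 2 f = 16 → IsStandard f

lemma invariant_standardOfNl : Invariant 2 StandardOfNl where
  of_add_mem f g h H hg := by
    have := H ((nl_eq_nl_of_add_mem h).trans hg)
    unfold IsStandard at *
    exact this.imp (affEquivMod_of_add_mem h) <| .imp (affEquivMod_of_add_mem h) <|
      .imp (affEquivMod_of_add_mem h) <| .imp (affEquivMod_of_add_mem h) (affEquivMod_of_add_mem h)
  comp_subst i j f hi h H hg := by
    obtain ⟨B, hB, b, hT⟩ := exists_subst_eq hi h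
    have e : f ∘ subst i j = fun x => f (B.mulVec x + b) := funext fun x => congrArg f (hT x)
    rw [e, nl_comp_mulVec_add f hB b] at hg
    have := H hg
    unfold IsStandard at *
    exact this.imp (affEquivMod_comp_subst hi h) <| .imp (affEquivMod_comp_subst hi h) <|
      .imp (affEquivMod_comp_subst hi h) <|
        .imp (affEquivMod_comp_subst hi h) (affEquivMod_comp_subst hi h)

/-- All functions in the coset of `f` modulo `RM 3 6` satisfy `StandardOfNl`. -/
def CosetStandard (f : BF 6) : Prop := ∀ g ∈ rm 3 6, StandardOfNl (f + g)

lemma invariant_cosetStandard : Invariant 3 CosetStandard where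
  of_add_mem f g h H q hq := by
    have := H (f + g + q) (add_mem h hq)
    rwa [add_assoc f g, ← add_assoc f f, add_self_eq_zero, zero_add] at this
  comp_subst i j f hi h H q hq := by
    have := invariant_standardOfNl.comp_subst i j _ hi h
      (H (q ∘ subst i j) (comp_mem_rm hq (subst_mem_rm i j)))
    convert this using 1
    ext x
    simp [subst_subst h]

/-- `t` is the truth table of `f`. -/
def IsTable (f : BF 6) (t : ℕ) : Prop := ∀ n < 64, f (point n) = if t.testBit n then 1 else 0

lemma IsTable.add {f g : BF 6} {s t : ℕ} (hf : IsTable f s) (hg : IsTable g t) :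
    IsTable (f + g) (s ^^^ t) := by
  intro n hn
  rw [Pi.add_apply, hf n hn, hg n hn, Nat.testBit_xor]
  cases s.testBit n <;> cases t.testBit n <;> decide

lemma IsTable.eq {f g : BF 6} {t : ℕ} (hf : IsTable f t) (hg : IsTable g t) : f = g := by
  ext x
  obtain ⟨n, hn, rfl⟩ := exists_point x
  rw [hf n hn, hg n hn]

lemma IsTable.hd_eq {f g : BF 6} {t : ℕ} (h : IsTable (f + g) t) : hd f g = countOnes t := by
  rw [hd_eq_count, countOnes, Nat.count_eq_card_filter_range, Nat.count_eq_card_filter_range]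
  congr 1
  refine Finset.filter_congr fun n hn => ?_
  have h₁ := h n (Finset.mem_range.1 hn)
  rw [Pi.add_apply] at h₁
  have : ∀ a b c : ZMod 2, a + b = c → (a ≠ b ↔ c = 1) := by decide
  rw [this _ _ _ h₁]
  simp

lemma truthTable_xor (a b : ℕ) : truthTable (a ^^^ b) = truthTable a ^^^ truthTable b := by
  have step : ∀ a b M s : ℕ, (a ^^^ b) ^^^ (((a ^^^ b) &&& M) <<< s) =
      (a ^^^ ((a &&& M) <<< s)) ^^^ (b ^^^ ((b &&& M) <<< s)) := by
    intro a b M s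
    rw [Nat.and_xor_distrib_right, Nat.shiftLeft_xor_distrib]
    ac_rfl
  simp only [truthTable, List.foldl_cons, List.foldl_nil, step]

/-- `a` is the algebraic normal form of `f`. -/
def IsNormalForm (f : BF 6) (a : ℕ) : Prop := IsTable f (truthTable a)

lemma IsNormalForm.add {f g : BF 6} {a b : ℕ} (hf : IsNormalForm f a) (hg : IsNormalForm g b) :
    IsNormalForm (f + g) (a ^^^ b) := by
  rw [IsNormalForm, truthTable_xor]; exact IsTable.add hf hg

lemma isNormalForm_zero : IsNormalForm 0 0 := by
  intro n _
  have : truthTable 0 = 0 := by decide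
  simp [this]

lemma isNormalForm_mon {m : ℕ} (hm : m < 64) : IsNormalForm (mon m) (2 ^ m) := by
  intro n hn
  rw [mon_point]
  have : ∀ m < 64, ∀ n < 64, (∀ i : Fin 6, m.testBit i → n.testBit i) ↔
      (truthTable (2 ^ m)).testBit n = true := by decide +kernel
  simp only [this m hm n hn]

lemma isNormalForm_sumMon {F : List ℕ} (hF : ∀ m ∈ F, m < 64) :
    IsNormalForm (sumMon F) (listSum F) := by
  induction F with
  | nil => exact isNormalForm_zero
  | cons m F ih =>
    rw [List.forall_mem_cons] at hF
    have := (ih hF.2).add (isNormalForm_mon hF.1)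
    rwa [add_comm] at this

lemma getD_mem {W : List ℕ} {k : ℕ} (h : k < W.length) : W.getD k 0 ∈ W := by
  rw [List.getD_eq_getElem _ _ h]; exact List.getElem_mem _

lemma isNormalForm_linSum {W : List ℕ} (hW : ∀ m ∈ W, m < 64) (c : ℕ) :
    IsNormalForm (linSum W c) (monSum W c) := by
  have : ∀ k ∈ List.range W.length, k < W.length := by simp
  unfold linSum monSum
  revert this
  generalize List.range W.length = K
  induction K with
  | nil => exact fun _ => isNormalForm_zero
  | cons k K ih =>
    intro hK
    rw [List.forall_mem_cons] at hK
    rw [List.map_cons, List.sum_cons, List.foldr_cons]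
    split_ifs
    · rw [add_comm]
      exact (ih hK.2).add (isNormalForm_mon (hW _ (getD_mem hK.1)))
    · rw [zero_add]
      exact ih hK.2

lemma testBit_valueSet {W : List ℕ} (hW : ∀ m ∈ W, m < 64) {f : BF 6} {t : ℕ}
    (hf : IsTable f t) {n : ℕ} (hn : n < 64) {c : ℕ} (hc : c < 2 ^ W.length) :
    (f + linSum W c) (point n) = if (valueSet W t n).testBit c then 1 else 0 := by
  have : ∀ k ∈ List.range W.length, k < W.length := by simp
  unfold linSum valueSet
  revert this
  generalize List.range W.length = K
  induction K with
  | nil =>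
    intro _
    simp only [List.map_nil, List.sum_nil, add_zero, List.foldr_nil, hf n hn]
    cases t.testBit n <;> simp [testBit_fullMask, hc]
  | cons k K ih =>
    intro hK
    rw [List.forall_mem_cons] at hK
    rw [List.map_cons, List.sum_cons, List.foldr_cons, add_left_comm, Pi.add_apply, ih hK.2]
    have h₁ : ∀ m < 64, ∀ n < 64, (∀ i : Fin 6, m.testBit i → n.testBit i) ↔
      m &&& n = m := by decide +kernel
    have h₂ := hW _ (getD_mem hK.1)
    have h₃ := mon_point (W.getD k 0) n
    simp only [h₁ _ h₂ n hn] at h₃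
    generalize List.foldr _ _ K = V
    split_ifs with h₄ h₅ h₅ <;> simp_all [testBit_bitMask, Nat.testBit_xor]
    exact CharTwo.add_self_eq_zero 1

lemma testBit_countSet (W : List ℕ) (t x n a b c d e s : ℕ)
    (h : (countSet W t n a b c d e s).testBit x = true) :
    s.testBit x = true ∨ 32 ≤ (a.testBit x).toNat + 2 * (b.testBit x).toNat +
      4 * (c.testBit x).toNat + 8 * (d.testBit x).toNat + 16 * (e.testBit x).toNat +
      Nat.count (fun i => (valueSet W t i).testBit x = true) n := by
  induction n generalizing a b c d e s with
  | zero => exact .inl h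
  | succ n ih =>
    have := ih _ _ _ _ _ _ h
    rw [Nat.count_succ]
    simp only [Nat.testBit_xor, Nat.testBit_and, Nat.testBit_or] at this
    revert this
    generalize Nat.count (fun i => (valueSet W t i).testBit x = true) n = N
    cases (valueSet W t n).testBit x <;> cases a.testBit x <;> cases b.testBit x <;>
      cases c.testBit x <;> cases d.testBit x <;> cases e.testBit x <;> cases s.testBit x <;>
      simp <;> omega

lemma monomials_lt : (∀ m ∈ cubics, m < 64) ∧ (∀ m ∈ lowMonomials, m < 64) ∧
    ∀ m ∈ highMonomials, m < 64 := by
  refine ⟨?_, ?_, ?_⟩ <;> intro m hm <;> exact List.mem_range.1 (List.mem_filter.1 hm).1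

lemma nl_le_of_isNormalForm {f : BF 6} {a : ℕ} (h : IsNormalForm f a) (q : ℕ) :
    nl 2 f ≤ countOnes (truthTable (a ^^^ monSum lowMonomials q)) := by
  rw [← IsTable.hd_eq (h.add (isNormalForm_linSum monomials_lt.2.1 q))]
  refine nl_le f (list_sum_mem fun g hg => ?_)
  obtain ⟨k, hk, rfl⟩ := List.mem_map.1 hg
  split_ifs
  · exact mon_mem_rm (of_decide_eq_true
      (List.mem_filter.1 (getD_mem (W := lowMonomials) (List.mem_range.1 hk))).2)
  · exact zero_mem _

/-- Counting with initial value given by bits `a`, ..., `e`, all functions `t + q` with `q` of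
degree at most 2 reach 32. -/
def reaches (t : ℕ) (a b c d e : Bool) : Bool :=
  let v (b : Bool) := if b then fullMask lowMonomials.length else 0
  Nat.beq (countSet lowMonomials t 64 (v a) (v b) (v c) (v d) (v e) 0)
    (fullMask lowMonomials.length)

lemma le_nl_of_reaches {f : BF 6} {s : ℕ} (h : IsNormalForm f s) {a b c d e : Bool}
    (hr : reaches (truthTable s) a b c d e = true) :
    32 ≤ a.toNat + 2 * b.toNat + 4 * c.toNat + 8 * d.toNat + 16 * e.toNat + nl 2 f := by
  obtain ⟨g, hg, hn⟩ := exists_hd_eq_nl 2 f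
  have hlow : ∀ m < 64, deg m ≤ 2 → m ∈ lowMonomials ∨ mon m ∈ (⊥ : AddSubgroup (BF 6)) :=
    fun m hm hd => .inl (List.mem_filter.2 ⟨List.mem_range.2 hm, decide_eq_true hd⟩)
  obtain ⟨x, hx, hgx⟩ := exists_linSum lowMonomials 2 ⊥ hlow hg
  have hg' : g = linSum lowMonomials x := by
    have := add_left_cancel (((AddSubgroup.mem_bot).1 hgx).trans (add_self_eq_zero g).symm)
    exact this.symm
  have hv : ∀ b : Bool, (if b then fullMask lowMonomials.length else 0).testBit x = b := by
    intro b
    cases b <;> simp [testBit_fullMask, hx]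
  have hb : (countSet lowMonomials (truthTable s) 64 (if a then fullMask lowMonomials.length else 0)
      (if b then fullMask lowMonomials.length else 0) (if c then fullMask lowMonomials.length else 0)
      (if d then fullMask lowMonomials.length else 0) (if e then fullMask lowMonomials.length else 0)
      0).testBit x = true := by
    have := Nat.eq_of_beq_eq_true hr
    simp only at this
    rw [this, testBit_fullMask]
    exact decide_eq_true hx
  have := (testBit_countSet _ _ _ _ _ _ _ _ _ _ hb).resolve_left (by simp)
  simp only [hv] at this
  convert this using 2
  rw [hn, hg', hd_eq_count, Nat.count_eq_card_filter_range, Nat.count_eq_card_filter_range]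
  congr 1
  refine Finset.filter_congr fun n hn => ?_
  have h₁ := testBit_valueSet monomials_lt.2.1 h (Finset.mem_range.1 hn) hx
  rw [Pi.add_apply] at h₁
  have : ∀ a b c : ZMod 2, a + b = c → (a ≠ b ↔ c = 1) := by decide
  rw [this _ _ _ h₁]
  simp

lemma sum_mon (m : ℕ) : ∑ x, mon m x = if deg m = 6 then 1 else 0 := by
  have h := Finset.prod_univ_sum (fun _ : Fin 6 => (Finset.univ : Finset (ZMod 2)))
    fun i c => if m.testBit i then c else 1
  rw [Fintype.piFinset_univ] at h
  refine Eq.trans h.symm ?_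
  have : ∀ b : Bool, ∑ c : ZMod 2, (if b then c else 1) = if b then 1 else 0 := by decide
  simp only [this, Fin.prod_univ_six, deg]
  have : ∀ a b c d e f : Bool, (if a then 1 else 0) * (if b then 1 else 0) * (if c then 1 else 0) *
      (if d then 1 else 0) * (if e then 1 else 0) * (if f then 1 else 0) =
      if a.toNat + b.toNat + c.toNat + d.toNat + e.toNat + f.toNat = 6 then (1 : ZMod 2) else 0 := by
    decide
  exact this _ _ _ _ _ _

lemma sum_eq_zero_of_mem_rm {f : BF 6} (hf : f ∈ rm 5 6) : ∑ x, f x = 0 := by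
  refine AddSubgroup.closure_induction (p := fun (f : BF 6) _ => ∑ x : Fin 6 → ZMod 2, f x = 0)
    ?_ ?_ ?_ ?_ (mem_closure_mon hf)
  · rintro _ ⟨m, -, hd, rfl⟩
    rw [sum_mon, if_neg (by omega)]
  · exact Finset.sum_eq_zero fun _ _ => rfl
  · rintro f g - - hf hg
    exact Finset.sum_add_distrib.trans (by rw [hf, hg, add_zero])
  · rintro f - hf
    exact (Finset.sum_neg_distrib _).trans (by rw [hf, neg_zero])

lemma hd_cast {n : ℕ} (f g : BF n) : (hd f g : ZMod 2) = ∑ x, (f x + g x) := by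
  rw [hd, Finset.card_filter, Nat.cast_sum]
  refine Finset.sum_congr rfl fun x _ => ?_
  have : ∀ a b : ZMod 2, ((if a ≠ b then 1 else 0 : ℕ) : ZMod 2) = a + b := by decide
  exact this _ _

lemma nl_ne_of_sum_eq_one {f : BF 6} (h : ∑ x, f x = 1) : nl 2 f ≠ 16 := by
  intro h16
  obtain ⟨g, hg, hn⟩ := exists_hd_eq_nl 2 f
  have := hd_cast f g
  rw [← hn, h16, Finset.sum_add_distrib, h, sum_eq_zero_of_mem_rm (rm_mono (by norm_num) hg)] at this
  exact absurd this (by decide)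

/-- The index `c` describes a representative of low second-order nonlinearity, with `q` a
quadratic approximation, of the coset of `F`. -/
def close (F : List ℕ) (p : ℕ × ℕ) : Bool :=
  Nat.ble (countOnes (truthTable ((listSum F ^^^ monSum cubics p.1) ^^^ monSum lowMonomials p.2))) 15

lemma standardOfNl_of_close {F : List ℕ} (hF : ∀ m ∈ F, m < 64) {p : ℕ × ℕ}
    (h : close F p = true) : StandardOfNl (sumMon F + linSum cubics p.1) := by
  intro h16
  have := nl_le_of_isNormalForm
    ((isNormalForm_sumMon hF).add (isNormalForm_linSum monomials_lt.1 p.1)) p.2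
  have := this.trans (Nat.le_of_ble_eq_true h)
  omega

lemma eq_sumMon {F G W : List ℕ} (hF : ∀ m ∈ F, m < 64) (hG : ∀ m ∈ G, m < 64)
    (hW : ∀ m ∈ W, m < 64) {c : ℕ} (h : listSum F ^^^ monSum W c = listSum G) :
    sumMon F + linSum W c = sumMon G :=
  IsTable.eq ((isNormalForm_sumMon hF).add (isNormalForm_linSum hW c))
    (h ▸ isNormalForm_sumMon hG)

lemma closed_cubics : Closed cubics 2 := by decide +kernel

lemma closed_highMonomials : Closed highMonomials 3 := by decide +kernel

/-- It suffices to check the representatives of a coset, those in the list `reps` by `close`. -/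
lemma cosetStandard_of_covers {F : List ℕ} (hF : ∀ m ∈ F, m < 64) {G : List ℕ}
    {reps : List (ℕ × ℕ)} {ws : List (List (ℕ × ℕ))}
    (h : covers cubics 2 F (G ++ reps.map Prod.fst) ws = true)
    (hG : ∀ c ∈ G, StandardOfNl (sumMon F + linSum cubics c))
    (hreps : reps.all (close F) = true) : CosetStandard (sumMon F) := by
  intro g hg
  have key := forall_of_covers invariant_standardOfNl closed_cubics h fun c hc => by
    rcases List.mem_append.1 hc with hc | hc
    · exact hG c hc
    · obtain ⟨p, hp, rfl⟩ := List.mem_map.1 hc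
      exact standardOfNl_of_close hF (List.all_eq_true.1 hreps p hp)
  have hcub : ∀ m < 64, deg m ≤ 3 → m ∈ cubics ∨ mon m ∈ rm 2 6 := by
    intro m hm hd
    by_cases h3 : deg m = 3
    · exact .inl (List.mem_filter.2 ⟨List.mem_range.2 hm, decide_eq_true h3⟩)
    · exact .inr (mon_mem_rm (by omega))
  obtain ⟨c, hc, hgc⟩ := exists_linSum cubics 3 (rm 2 6) hcub hg
  refine invariant_standardOfNl.of_add_mem _ _ ?_ (key c hc)
  rwa [add_add_add_comm, add_self_eq_zero, zero_add, add_comm]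

lemma fun1_eq : fun1 = sumMon [35, 21, 14] := by
  ext x
  simp [fun1, sumMon, mon, Fin.prod_univ_six, Nat.testBit]
  ring

lemma fun2_eq : fun2 = sumMon [15, 35, 25, 22] := by
  ext x
  simp [fun2, sumMon, mon, Fin.prod_univ_six, Nat.testBit]
  ring

lemma fun3_eq : fun3 = sumMon [15, 21, 41, 22, 38, 26] := by
  ext x
  simp [fun3, sumMon, mon, Fin.prod_univ_six, Nat.testBit]
  ring

lemma fun4_eq : fun4 = sumMon [39, 27, 21, 25, 41, 14] := by
  ext x
  simp [fun4, sumMon, mon, Fin.prod_univ_six, Nat.testBit]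
  ring

lemma fun5_eq : fun5 = sumMon [31, 21, 41, 22, 38, 26] := by
  ext x
  simp [fun5, sumMon, mon, Fin.prod_univ_six, Nat.testBit]
  ring

lemma nl_sumMon_eq_sixteen {F : List ℕ} (hF : ∀ m ∈ F, m < 64) (q : ℕ)
    (h : Nat.ble (countOnes (truthTable (listSum F ^^^ monSum lowMonomials q))) 16 = true)
    (hr : reaches (truthTable (listSum F)) false false false false true = true) :
    nl 2 (sumMon F) = 16 := by
  have h₁ := (nl_le_of_isNormalForm (isNormalForm_sumMon hF) q).trans (Nat.le_of_ble_eq_true h)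
  have h₂ := le_nl_of_reaches (isNormalForm_sumMon hF) hr
  simp only [Bool.toNat_false, Bool.toNat_true] at h₂
  omega

lemma nl_fun1 : nl 2 fun1 = 16 :=
  fun1_eq ▸ nl_sumMon_eq_sixteen (by decide) 0 (by decide +kernel) (by decide +kernel)

lemma nl_fun2 : nl 2 fun2 = 16 :=
  fun2_eq ▸ nl_sumMon_eq_sixteen (by decide) 0 (by decide +kernel) (by decide +kernel)

lemma nl_fun3 : nl 2 fun3 = 16 :=
  fun3_eq ▸ nl_sumMon_eq_sixteen (by decide) 2158656 (by decide +kernel) (by decide +kernel)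

lemma nl_fun4 : nl 2 fun4 = 16 :=
  fun4_eq ▸ nl_sumMon_eq_sixteen (by decide) 0 (by decide +kernel) (by decide +kernel)

lemma nl_fun5 : nl 2 fun5 = 16 :=
  fun5_eq ▸ nl_sumMon_eq_sixteen (by decide) 0 (by decide +kernel) (by decide +kernel)

lemma standardOfNl_of_eq {F G : List ℕ} (hF : ∀ m ∈ F, m < 64) (hG : ∀ m ∈ G, m < 64) {c : ℕ}
    (h : Nat.beq (listSum F ^^^ monSum cubics c) (listSum G) = true)
    (H : IsStandard (sumMon G)) : StandardOfNl (sumMon F + linSum cubics c) := by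
  rw [eq_sumMon hF hG monomials_lt.1 (Nat.eq_of_beq_eq_true h)]
  exact fun _ => H

lemma isStandard_fun : IsStandard fun1 ∧ IsStandard fun2 ∧ IsStandard fun3 ∧ IsStandard fun4 ∧
    IsStandard fun5 :=
  ⟨.inl (affEquivMod_refl _ _ _), .inr (.inl (affEquivMod_refl _ _ _)),
    .inr (.inr (.inl (affEquivMod_refl _ _ _))),
    .inr (.inr (.inr (.inl (affEquivMod_refl _ _ _)))),
    .inr (.inr (.inr (.inr (affEquivMod_refl _ _ _))))⟩

/-- If the count started at 15 always reaches 32, then the nonlinearity exceeds 16. -/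
lemma standardOfNl_of_reaches {F : List ℕ} (hF : ∀ m ∈ F, m < 64) {c : ℕ}
    (h : reaches (truthTable (listSum F ^^^ monSum cubics c)) true true true true false = true) :
    StandardOfNl (sumMon F + linSum cubics c) := by
  intro h16
  have := le_nl_of_reaches
    ((isNormalForm_sumMon hF).add (isNormalForm_linSum monomials_lt.1 c)) h
  simp only [Bool.toNat_false, Bool.toNat_true] at this
  omega

lemma cosetStandard_zero : CosetStandard (sumMon []) := by
  refine cosetStandard_of_covers (G := [1064, 12640])
    (reps :=
      [(0, 0), (1, 0), (20, 0), (1536, 0)])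
    (ws :=
      [[(0, 3)], [(1, 3)], [(0, 4)], [(2, 5)], [(3, 5)], [(2, 1)], [(4, 5)], [(3, 1)], [(5, 4)],
      [(5, 2)], [(1, 2)], [(4, 0)], [(5, 3)], [(1, 0)], [(0, 1)], [(5, 0)], [(0, 5)], [(2, 5)],
      [(1, 4)], [(4, 1)], [(3, 5)], [(5, 0)], [(5, 4)], [(1, 3)], [(4, 2)], [(4, 1)]])
    (by decide) (by decide +kernel) ?_ (by decide +kernel)
  rw [List.forall_mem_cons, List.forall_mem_singleton]
  constructor
  · exact standardOfNl_of_eq (by decide) (by decide) (by decide +kernel)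
      (fun1_eq ▸ isStandard_fun.1)
  · exact standardOfNl_of_reaches (by decide) (by decide +kernel)

lemma cosetStandard_quartic : CosetStandard (sumMon [15]) := by
  refine cosetStandard_of_covers (G := [1216, 12640])
    (reps :=
      [(0, 0), (16, 0), (192, 64), (1056, 0), (1536, 0), (65536, 0), (65600, 2097152), (69888,
      0)])
    (ws :=
      [[(3, 6)], [(1, 6)], [(0, 6)], [(2, 6)], [(0, 2)], [(0, 3)], [(4, 5)], [(2, 0)], [(1, 0)],
      [(0, 1)], [(5, 4)], [(3, 0)], [(1, 3)], [(3, 1)], [(0, 2)], [(5, 2)], [(4, 2)], [(2, 3)],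
      [(3, 2)], [(5, 1)], [(4, 0)], [(4, 1)], [(1, 2)], [(5, 0)], [(0, 1)], [(1, 3)], [(3, 1)]])
    (by decide) (by decide +kernel) ?_ (by decide +kernel)
  rw [List.forall_mem_cons, List.forall_mem_singleton]
  constructor
  · exact standardOfNl_of_eq (by decide) (by decide) (by decide +kernel)
      (fun2_eq ▸ isStandard_fun.2.1)
  · exact standardOfNl_of_eq (by decide) (by decide) (by decide +kernel)
      (fun3_eq ▸ isStandard_fun.2.2.1)

lemma cosetStandard_quartics_of_two : CosetStandard (sumMon [27, 39]) := by
  refine cosetStandard_of_covers (G := [8360])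
    (reps :=
      [(0, 0), (4, 0), (40, 0), (128, 0), (136, 0), (512, 32768), (8256, 0), (8352, 0), (8384, 0),
      (8704, 0), (82432, 32768)])
    (ws :=
      [[(0, 6)], [(2, 6)], [(3, 6)], [(1, 6)], [(4, 6)], [(5, 6)], [(2, 5)], [(0, 1)], [(5, 2)],
      [(1, 0)], [(3, 4)], [(4, 3)], [(4, 5), (2, 3)], [(3, 4)], [(5, 2)], [(3, 0)], [(3, 1)], [(2,
      1)], [(2, 0)], [(4, 3)], [(5, 0)], [(5, 1)], [(4, 5), (2, 3)], [(3, 4)], [(0, 1)], [(5, 1)],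
      [(2, 5)]])
    (by decide) (by decide +kernel) ?_ (by decide +kernel)
  rw [List.forall_mem_singleton]
  exact standardOfNl_of_eq (by decide) (by decide) (by decide +kernel)
      (fun4_eq ▸ isStandard_fun.2.2.2.1)

lemma cosetStandard_quartics_of_three : CosetStandard (sumMon [15, 51, 60]) := by
  refine cosetStandard_of_covers (G := [])
    (reps :=
      [(0, 0), (1, 0), (21, 0), (42, 2120192), (1066, 8), (1216, 8)])
    (ws :=
      [[(3, 6)], [(5, 6)], [(4, 6)], [(2, 6)], [(0, 6)], [(1, 6)], [(2, 3)], [(3, 2)], [(4, 5)],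
      [(5, 4)], [(0, 1)], [(1, 0)], [(5, 1), (0, 4)], [(4, 5)], [(1, 0)], [(0, 1)], [(2, 3)], [(3,
      1), (0, 2)], [(1, 0)], [(2, 3)], [(5, 4)], [(3, 2)], [(0, 1)], [(5, 1), (0, 4)], [(4, 5)],
      [(1, 0)], [(3, 1), (0, 2)], [(5, 4)], [(2, 3)], [(1, 0)], [(3, 2)], [(0, 1)], [(5, 1), (0,
      4)], [(4, 5)]])
    (by decide) (by decide +kernel) ?_ (by decide +kernel)
  simp

lemma cosetStandard_quintic : CosetStandard (sumMon [31]) := by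
  refine cosetStandard_of_covers (G := [12640])
    (reps :=
      [(0, 0), (1, 0), (20, 8), (1024, 0), (1028, 131072), (1064, 131104), (1536, 131072), (12288,
      131072), (12304, 0), (12352, 0)])
    (ws :=
      [[(0, 6), (0, 4)], [(1, 6), (1, 3)], [(5, 2)], [(5, 3)], [(5, 4)], [(1, 6), (1, 4)], [(3,
      6), (3, 1)], [(0, 6), (0, 1)], [(0, 6), (0, 2)], [(1, 6), (1, 0)], [(2, 6), (2, 0)], [(4,
      6), (4, 1)], [(2, 6), (2, 1)], [(1, 6), (1, 2)], [(3, 6), (3, 4)], [(4, 6), (4, 0)], [(1,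
      6), (1, 3)], [(5, 0)], [(0, 6), (0, 1)], [(3, 6), (3, 1)], [(0, 6), (0, 4)], [(4, 6), (4,
      3)], [(3, 6), (3, 0)], [(1, 6), (1, 3)], [(2, 4), (2, 3)]])
    (by decide) (by decide +kernel) ?_ (by decide +kernel)
  rw [List.forall_mem_singleton]
  exact standardOfNl_of_eq (by decide) (by decide) (by decide +kernel)
      (fun5_eq ▸ isStandard_fun.2.2.2.2)

lemma cosetStandard_quintic_add_quartic : CosetStandard (sumMon [31, 39]) := by
  refine cosetStandard_of_covers (G := [])
    (reps :=
      [(0, 0), (2, 0), (20, 0), (128, 0), (136, 32768), (1024, 0), (1028, 0), (1064, 8), (1152,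
      0), (1160, 256), (1536, 0), (8192, 131072), (8200, 131072), (8208, 0), (8216, 8), (8256, 0),
      (8448, 0), (8480, 32768), (8512, 139264), (12288, 1048576), (12304, 131072), (12352,
      131072), (12544, 1048576), (12608, 1253376), (12640, 1048576), (81920, 0), (81924, 131072),
      (81928, 131072), (81996, 3725408), (82432, 4063232), (82440, 33280), (524288, 32768),
      (524290, 0), (524308, 32768), (525312, 0), (525316, 33024), (525352, 4608)])
    (ws :=
      [[(5, 6)], [(0, 6), (0, 2)], [(5, 2)], [(5, 1)], [(3, 6), (3, 2)], [(3, 6), (3, 4)], [(5,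
      4), (3, 6)], [(2, 6), (2, 0)], [(4, 6), (4, 3)], [(1, 6), (1, 2)], [(2, 6), (2, 1)], [(4,
      6), (4, 1)], [(4, 6), (4, 2)], [(1, 6), (1, 0)], [(0, 6), (0, 1)], [(5, 3), (4, 6)], [(3,
      6), (3, 0)], [(3, 6), (3, 1)], [(5, 0)], [(4, 6), (4, 0)], [(1, 6), (1, 0)], [(2, 6), (2,
      1)], [(0, 6), (0, 2)], [(3, 6), (3, 4)], [(1, 6), (1, 0)]])
    (by decide) (by decide +kernel) ?_ (by decide +kernel)
  simp

lemma cosetStandard_quintic_add_quartics : CosetStandard (sumMon [31, 39, 57]) := by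
  refine cosetStandard_of_covers (G := [])
    (reps :=
      [(0, 0), (1, 0), (3, 0), (8, 0), (20, 135464), (24, 64), (4096, 0), (4098, 0), (4104, 0),
      (4116, 64), (4120, 64), (4352, 0), (4356, 33792), (4360, 0), (4392, 64), (16384, 0), (16388,
      262144), (16404, 8), (16416, 0), (16448, 0), (16452, 64), (16648, 512), (16649, 0), (16680,
      512), (16681, 0), (163840, 4063232), (163841, 0), (163842, 2621440), (163844, 4064691),
      (163845, 1320324), (163879, 12650), (167936, 0), (167937, 3997696), (167938, 262144),
      (528384, 0), (528385, 64), (528386, 0), (528405, 1088)])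
    (ws :=
      [[(5, 6)], [(5, 3), (4, 6)], [(5, 2), (1, 6)], [(5, 1), (2, 6)], [(5, 4), (3, 6)], [(5, 0)],
      [(3, 6), (3, 4)], [(1, 6), (1, 0)], [(4, 6), (4, 3)], [(1, 6), (1, 2)], [(2, 6), (2, 1)],
      [(3, 6), (3, 0)], [(4, 6), (4, 0)], [(2, 6), (2, 0)], [(4, 2), (4, 6), (1, 3), (1, 0)], [(3,
      6), (3, 4)], [(2, 6), (2, 1)], [(1, 6), (1, 2)], [(4, 6), (4, 3)], [(4, 2), (4, 6), (1, 3),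
      (1, 0)], [(2, 6), (2, 1)], [(3, 6), (3, 4)], [(4, 2), (4, 6), (1, 3), (1, 0)], [(2, 6), (2,
      1)]])
    (by decide) (by decide +kernel) ?_ (by decide +kernel)
  simp

lemma cosetStandard_linSum {F : List ℕ} (hF : ∀ m ∈ F, m < 64) {c : ℕ}
    (h : Nat.beq (listSum [] ^^^ monSum highMonomials c) (listSum F) = true)
    (H : CosetStandard (sumMon F)) : CosetStandard (sumMon [] + linSum highMonomials c) := by
  rwa [eq_sumMon (by decide) hF monomials_lt.2.2 (Nat.eq_of_beq_eq_true h)]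

lemma cosetStandard_linSum_highMonomials :
    ∀ c < 2 ^ highMonomials.length, CosetStandard (sumMon [] + linSum highMonomials c) := by
  refine forall_of_covers (reps := [0, 1, 68, 264193, 32, 96, 32864])
    (ws :=
      [[(1, 6)], [(3, 6)], [(0, 6)], [(2, 6)], [(4, 6)], [(0, 5)], [(1, 5)], [(3, 5)], [(2, 5)],
      [(4, 5)], [(5, 4)], [(1, 3)], [(0, 3)], [(2, 3)], [(1, 4)], [(0, 4)], [(3, 1)], [(5, 2)],
      [(4, 0)], [(4, 1)], [(2, 5)], [(5, 4)], [(0, 1)], [(1, 5)], [(2, 0)], [(5, 3)], [(3, 2)],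
      [(2, 3)], [(3, 0)], [(4, 3)], [(5, 4)]])
    invariant_cosetStandard closed_highMonomials (by decide +kernel) ?_
  simp only [List.forall_mem_cons, List.not_mem_nil, false_imp_iff, implies_true, and_true]
  exact ⟨cosetStandard_linSum (by decide) (by decide +kernel) cosetStandard_zero,
    cosetStandard_linSum (by decide) (by decide +kernel) cosetStandard_quartic,
    cosetStandard_linSum (by decide) (by decide +kernel) cosetStandard_quartics_of_two,
    cosetStandard_linSum (by decide) (by decide +kernel) cosetStandard_quartics_of_three,
    cosetStandard_linSum (by decide) (by decide +kernel) cosetStandard_quintic,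
    cosetStandard_linSum (by decide) (by decide +kernel) cosetStandard_quintic_add_quartic,
    cosetStandard_linSum (by decide) (by decide +kernel) cosetStandard_quintic_add_quartics⟩

lemma standardOfNl_of_mem_rm {f : BF 6} (hf : f ∈ rm 5 6) : StandardOfNl f := by
  have hhigh : ∀ m < 64, deg m ≤ 5 → m ∈ highMonomials ∨ mon m ∈ rm 3 6 := by
    intro m hm hd
    by_cases h3 : deg m ≤ 3
    · exact .inr (mon_mem_rm h3)
    · exact .inl (List.mem_filter.2 ⟨List.mem_range.2 hm, decide_eq_true (by omega)⟩)
  obtain ⟨c, hc, hfc⟩ := exists_linSum highMonomials 5 (rm 3 6) hhigh hf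
  have := cosetStandard_linSum_highMonomials c hc (f + linSum highMonomials c) hfc
  have e : (sumMon [] : BF 6) = 0 := rfl
  rwa [e, zero_add, add_left_comm, add_self_eq_zero, add_zero] at this

lemma standardOfNl (f : BF 6) : StandardOfNl f := by
  obtain ⟨s, hs⟩ := exists_mem_rm f
  have hodd : ∀ m < 64, deg m ≤ s → m ∈ [63] ∨ mon m ∈ rm 5 6 := by
    have : ∀ m < 64, deg m ≤ 5 ∨ m = 63 := by decide
    intro m hm _
    rcases this m hm with h | h
    · exact .inr (mon_mem_rm h)
    · exact .inl (by simp [h])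
  obtain ⟨c, hc, hfc⟩ := exists_linSum [63] s (rm 5 6) hodd hs
  obtain rfl | rfl : c = 0 ∨ c = 1 := by
    change c < 2 at hc
    omega
  · rw [linSum_zero, add_zero] at hfc
    exact standardOfNl_of_mem_rm hfc
  · intro h
    refine absurd h (nl_ne_of_sum_eq_one ?_)
    have h₁ : linSum [63] 1 = mon 63 := linSum_two_pow [63] (k := 0) (by decide)
    have h₂ : ∑ x, (f + mon 63) x = ∑ x, f x + ∑ x, mon 63 x := Finset.sum_add_distrib
    rw [h₁] at hfc
    rw [sum_eq_zero_of_mem_rm hfc, sum_mon, if_pos (by decide)] at h₂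
    generalize ∑ x, f x = a at h₂ ⊢
    revert a
    decide

end QuadraticNonlinearity

/-- `nl_2(f) = 16` iff `f` is affine equivalent modulo `RM(2,6)` to one of
`fun1, ..., fun5`. -/
theorem stmt5 (f : BF 6) :
    nl 2 f = 16 ↔
      (AffEquivMod 2 6 f fun1 ∨ AffEquivMod 2 6 f fun2 ∨ AffEquivMod 2 6 f fun3 ∨
        AffEquivMod 2 6 f fun4 ∨ AffEquivMod 2 6 f fun5) := by
  refine ⟨QuadraticNonlinearity.standardOfNl f, ?_⟩
  rintro (h | h | h | h | h)
  · exact h.nl_eq.trans QuadraticNonlinearity.nl_fun1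
  · exact h.nl_eq.trans QuadraticNonlinearity.nl_fun2
  · exact h.nl_eq.trans QuadraticNonlinearity.nl_fun3
  · exact h.nl_eq.trans QuadraticNonlinearity.nl_fun4
  · exact h.nl_eq.trans QuadraticNonlinearity.nl_fun5
end
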